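/- Let H ∈ (0,1), let W^H be a fractional Brownian motion with Hurst parameter H, let g ∈ C²(ℝ) satisfy ∫₀¹ (g'(W^H_s))² ds > 0 P-a.s., and set V_t := ∫₀ᵗ g(W^H_s) ds for t ∈ [0,1]. Then, with probability one, |𝓡̂_n( V / √(τ_H ∫₀¹ (g'(W^H_s))² ds) ) − H| = O( n^{−1/2} · 2^{−(H/2 ∧ 1/4)n} ) as n → ∞. -/

import Mathlib

open MeasureTheory ProbabilityTheory Filter

/-- Approximated Faber–Schauder coefficient `ϑ^f_{n,k}`. -/
noncomputable def vartheta (f : ℝ → ℝ) (n k : ℕ) : ℝ :=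
  (2 : ℝ) ^ ((3 * (n : ℝ)) / 2 + 3) *
    (f ((4 * k) / 2 ^ (n + 2)) - 2 * f ((4 * k + 1) / 2 ^ (n + 2))
      + 2 * f ((4 * k + 3) / 2 ^ (n + 2)) - f ((4 * k + 4) / 2 ^ (n + 2)))

/-- The estimator `𝓡̂_n(f) = 1 - (1/n) log₂ √(Σ_k (ϑ^f_{n,k})²)`. -/
noncomputable def Rhat (n : ℕ) (f : ℝ → ℝ) : ℝ :=
  1 - (1 / (n : ℝ)) * Real.logb 2 (Real.sqrt (∑ k ∈ Finset.range (2 ^ n), (vartheta f n k) ^ 2))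

/-- Covariance function of fractional Brownian motion with Hurst parameter `H`. -/
noncomputable def fbmCov (H s t : ℝ) : ℝ :=
  (s ^ (2 * H) + t ^ (2 * H) - |s - t| ^ (2 * H)) / 2

/-- `W` is a fractional Brownian motion with Hurst parameter `H` on `[0,1]`:
it has a.s. continuous paths and centered Gaussian finite-dimensional distributions
with covariance `fbmCov H`. -/
def IsFBM {Ω : Type*} [MeasurableSpace Ω] (P : Measure Ω) (H : ℝ) (W : ℝ → Ω → ℝ) : Prop :=
  (∀ t, Measurable (W t)) ∧
  (∀ᵐ ω ∂P, ContinuousOn (fun t => W t ω) (Set.Icc 0 1)) ∧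
  ∀ (n : ℕ) (t c : Fin n → ℝ), (∀ i, t i ∈ Set.Icc (0 : ℝ) 1) →
    Measure.map (fun ω => ∑ i, c i * W (t i) ω) P =
      gaussianReal 0 (Real.toNNReal (∑ i, ∑ j, c i * c j * fbmCov H (t i) (t j)))


lemma integral_pow_four_gaussianReal_one : ∫ x, x ^ 4 ∂(gaussianReal 0 1) = 3 := by
  have h := iteratedDeriv_mgf_zero (X := id) (μ := gaussianReal 0 1)
    (by simp [integrableExpSet_id_gaussianReal]) 4
  have e : mgf id (gaussianReal 0 1) = fun t => Real.exp (t ^ 2 / 2) := by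
    rw [mgf_id_gaussianReal]; simp
  have d (p p' q : ℝ → ℝ) (hp : ∀ t, HasDerivAt p (p' t) t) (hq : ∀ t, q t = p' t + t * p t) :
      deriv (fun t => p t * Real.exp (t ^ 2 / 2)) = fun t => q t * Real.exp (t ^ 2 / 2) := by
    funext t
    have h1 : HasDerivAt (fun t : ℝ => Real.exp (t ^ 2 / 2)) (Real.exp (t ^ 2 / 2) * t) t := by
      have := ((hasDerivAt_pow 2 t).div_const 2).exp
      convert this using 1
      simp
    rw [((hp t).fun_mul h1).deriv, hq]
    ring
  have h0 : mgf id (gaussianReal 0 1) = fun t => 1 * Real.exp (t ^ 2 / 2) := by simpa using e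
  have e4 : iteratedDeriv 4 (mgf id (gaussianReal 0 1)) =
      fun t => (t ^ 4 + 6 * t ^ 2 + 3) * Real.exp (t ^ 2 / 2) := by
    rw [h0]
    simp only [iteratedDeriv_succ, iteratedDeriv_zero]
    rw [d (fun _ => 1) (fun _ => 0) (fun t => t) (fun t => hasDerivAt_const t 1) (by simp),
      d (fun t => t) (fun _ => 1) (fun t => 1 + t ^ 2) (fun t => hasDerivAt_id' t)
        (fun t => by ring),
      d (fun t => 1 + t ^ 2) (fun t => 2 * t) (fun t => 3 * t + t ^ 3)
        (fun t => by simpa using (hasDerivAt_pow 2 t).const_add 1) (fun t => by ring),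
      d (fun t => 3 * t + t ^ 3) (fun t => 3 + 3 * t ^ 2) (fun t => t ^ 4 + 6 * t ^ 2 + 3)
        (fun t => by simpa using ((hasDerivAt_id' t).const_mul 3).fun_add (hasDerivAt_pow 3 t))
        (fun t => by ring)]
  rw [e4] at h
  simpa using h.symm

lemma integral_pow_four_gaussianReal (v : NNReal) :
    ∫ x, x ^ 4 ∂(gaussianReal 0 v) = 3 * (v : ℝ) ^ 2 := by
  have hmap : gaussianReal 0 v = (gaussianReal 0 1).map (fun x => Real.sqrt v * x) := by
    rw [gaussianReal_map_const_mul]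
    congr 1
    · simp
    · ext; simp
  rw [hmap, integral_map (by fun_prop) (by fun_prop)]
  simp_rw [mul_pow]
  rw [integral_const_mul, integral_pow_four_gaussianReal_one]
  have : Real.sqrt v ^ 4 = (Real.sqrt v ^ 2) ^ 2 := by ring
  rw [this, Real.sq_sqrt v.coe_nonneg]; ring

lemma integral_even_pow_gaussianReal (v : NNReal) (p : ℕ) :
    ∫ x, x ^ (2 * p) ∂(gaussianReal 0 v) =
      (v : ℝ) ^ p * ∫ x, x ^ (2 * p) ∂(gaussianReal 0 1) := by
  have hmap : gaussianReal 0 v = (gaussianReal 0 1).map (fun x => Real.sqrt v * x) := by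
    rw [gaussianReal_map_const_mul]
    congr 1
    · simp
    · ext; simp
  rw [hmap, integral_map (by fun_prop) (by fun_prop)]
  simp_rw [mul_pow]
  rw [integral_const_mul, pow_mul, Real.sq_sqrt v.coe_nonneg]

lemma integrable_pow_gaussianReal (v : NNReal) (p : ℕ) :
    Integrable (fun x : ℝ => x ^ p) (gaussianReal 0 v) := by
  have := (memLp_id_gaussianReal (μ := 0) (v := v) (p := p)).integrable_norm_pow'
  rw [← integrable_norm_iff (by fun_prop)]
  simpa using this

section law
variable {Ω : Type*} [MeasurableSpace Ω] {P : Measure Ω}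

lemma integrable_pow_of_map_eq_gaussianReal {X : Ω → ℝ} (hX : Measurable X) {v : NNReal}
    (h : P.map X = gaussianReal 0 v) (p : ℕ) : Integrable (fun ω => X ω ^ p) P := by
  have := integrable_pow_gaussianReal v p
  rw [← h] at this
  exact this.comp_measurable hX

lemma integral_sq_of_map_eq_gaussianReal {X : Ω → ℝ} (hX : AEMeasurable X P) {v : NNReal}
    (h : P.map X = gaussianReal 0 v) : ∫ ω, X ω ^ 2 ∂P = v := by
  have h1 : ∫ x, x ^ 2 ∂(P.map X) = ∫ ω, X ω ^ 2 ∂P := integral_map hX (by fun_prop)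
  have h2 := variance_fun_id_gaussianReal (μ := 0) (v := v)
  rw [variance_eq_integral (by fun_prop)] at h2
  rw [← h1, h]
  simpa using h2

lemma integral_pow_four_of_map_eq_gaussianReal {X : Ω → ℝ} (hX : AEMeasurable X P) {v : NNReal}
    (h : P.map X = gaussianReal 0 v) : ∫ ω, X ω ^ 4 ∂P = 3 * (v : ℝ) ^ 2 := by
  have h1 : ∫ x, x ^ 4 ∂(P.map X) = ∫ ω, X ω ^ 4 ∂P := integral_map hX (by fun_prop)
  rw [← h1, h, integral_pow_four_gaussianReal]

/-- Two random variables whose linear combinations are centered Gaussian, with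
`a`, `r`, `b` as entries of their covariance matrix. -/
def IsGaussPair (P : Measure Ω) (X Y : Ω → ℝ) (a r b : ℝ) : Prop :=
  ∀ s t : ℝ, ∃ v : NNReal, (v : ℝ) = s ^ 2 * a + 2 * s * t * r + t ^ 2 * b ∧
    P.map (fun ω => s * X ω + t * Y ω) = gaussianReal 0 v

lemma IsGaussPair.integral_sq_mul_sq {X Y : Ω → ℝ} {a r b : ℝ} (hX : Measurable X)
    (hY : Measurable Y) (h : IsGaussPair P X Y a r b) :
    Integrable (fun ω => X ω ^ 2 * Y ω ^ 2) P ∧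
      ∫ ω, X ω ^ 2 * Y ω ^ 2 ∂P = a * b + 2 * r ^ 2 := by
  have key (s t : ℝ) : Integrable (fun ω => (s * X ω + t * Y ω) ^ 4) P ∧
      ∫ ω, (s * X ω + t * Y ω) ^ 4 ∂P = 3 * (s ^ 2 * a + 2 * s * t * r + t ^ 2 * b) ^ 2 := by
    obtain ⟨v, hv, hl⟩ := h s t
    have hm : Measurable (fun ω => s * X ω + t * Y ω) := by fun_prop
    refine ⟨integrable_pow_of_map_eq_gaussianReal hm hl 4, ?_⟩
    rw [integral_pow_four_of_map_eq_gaussianReal hm.aemeasurable hl, hv]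
  obtain ⟨i1, e1⟩ := key 1 1
  obtain ⟨i2, e2⟩ := key 1 (-1)
  obtain ⟨i3, e3⟩ := key 1 0
  obtain ⟨i4, e4⟩ := key 0 1
  have e : (fun ω => X ω ^ 2 * Y ω ^ 2) = fun ω => (1 / 12 : ℝ) *
      (((1 * X ω + 1 * Y ω) ^ 4 + (1 * X ω + (-1) * Y ω) ^ 4) -
        2 * ((1 * X ω + 0 * Y ω) ^ 4 + (0 * X ω + 1 * Y ω) ^ 4)) := by
    funext ω; ring
  rw [e]
  have j1 := i1.fun_add i2
  have j2 := (i3.fun_add i4).const_mul 2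
  refine ⟨(j1.sub j2).const_mul _, ?_⟩
  rw [integral_const_mul, integral_sub j1 j2,
    integral_const_mul, integral_add i1 i2, integral_add i3 i4, e1, e2, e3, e4]
  ring

lemma IsGaussPair.integral_sq_sub_mul [IsProbabilityMeasure P] {X Y : Ω → ℝ}
    {a r b : ℝ} (hX : Measurable X)
    (hY : Measurable Y) (h : IsGaussPair P X Y a r b) :
    Integrable (fun ω => (X ω ^ 2 - a) * (Y ω ^ 2 - b)) P ∧
      ∫ ω, (X ω ^ 2 - a) * (Y ω ^ 2 - b) ∂P = 2 * r ^ 2 := by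
  obtain ⟨i, e⟩ := h.integral_sq_mul_sq hX hY
  obtain ⟨v, hv, hl⟩ := h 1 0
  obtain ⟨u, hu, kl⟩ := h 0 1
  simp only [one_mul, zero_mul, add_zero, zero_add] at hl kl
  have iX := integrable_pow_of_map_eq_gaussianReal hX hl 2
  have iY := integrable_pow_of_map_eq_gaussianReal hY kl 2
  have eX := integral_sq_of_map_eq_gaussianReal hX.aemeasurable hl
  have eY := integral_sq_of_map_eq_gaussianReal hY.aemeasurable kl
  rw [hv] at eX
  rw [hu] at eY
  have ee : (fun ω => (X ω ^ 2 - a) * (Y ω ^ 2 - b)) = fun ω =>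
      ((X ω ^ 2 * Y ω ^ 2 - b * X ω ^ 2) - a * Y ω ^ 2) + a * b := by
    funext ω; ring
  rw [ee]
  have j1 : Integrable (fun ω => X ω ^ 2 * Y ω ^ 2 - b * X ω ^ 2) P := i.sub (iX.const_mul b)
  have j2 : Integrable (fun ω => X ω ^ 2 * Y ω ^ 2 - b * X ω ^ 2 - a * Y ω ^ 2) P :=
    j1.sub (iY.const_mul a)
  refine ⟨j2.add (integrable_const _), ?_⟩
  rw [integral_add j2 (integrable_const _), integral_sub j1 (iY.const_mul a),
    integral_sub i (iX.const_mul b), integral_const_mul, integral_const_mul, e, eX, eY]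
  simp
  ring

end law

lemma ae_bdd_of_summable {Ω : Type*} [MeasurableSpace Ω] {P : Measure Ω} (f : ℕ → Ω → ℝ)
    (hf : ∀ n, AEMeasurable (f n) P) (b : ℕ → ℝ) (hb : Summable b) (hb0 : ∀ n, 0 ≤ b n)
    (h : ∀ n, ∫⁻ ω, ENNReal.ofReal (f n ω) ∂P ≤ ENNReal.ofReal (b n)) :
    ∀ᵐ ω ∂P, ∃ C : ℝ, 0 ≤ C ∧ ∀ n, f n ω ≤ C := by
  have hm (n) : AEMeasurable (fun ω => ENNReal.ofReal (f n ω)) P := (hf n).ennreal_ofReal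
  have hfin : ∫⁻ ω, ∑' n, ENNReal.ofReal (f n ω) ∂P ≠ ⊤ := by
    rw [lintegral_tsum hm]
    refine ne_top_of_le_ne_top ?_ (ENNReal.tsum_le_tsum h)
    rw [← ENNReal.ofReal_tsum_of_nonneg hb0 hb]
    exact ENNReal.ofReal_ne_top
  filter_upwards [ae_lt_top' (AEMeasurable.tsum hm) hfin] with ω hω
  refine ⟨(∑' n, ENNReal.ofReal (f n ω)).toReal, ENNReal.toReal_nonneg, fun n => ?_⟩
  exact (ENNReal.ofReal_le_iff_le_toReal hω.ne).1 (ENNReal.le_tsum n)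

/-- Control of dyadic increments gives control of the oscillation on dyadic intervals. -/
lemma dyadic_holder {x : ℝ → ℝ} (hx : ContinuousOn x (Set.Icc 0 1)) {α : ℝ} (hα : 0 < α) {C : ℝ}
    (hC : 0 ≤ C)
    (h : ∀ n k : ℕ, k < 2 ^ n → |x ((k + 1) / 2 ^ n) - x (k / 2 ^ n)| ≤ C * (2 : ℝ) ^ (-α * n)) :
    ∃ C' : ℝ, 0 ≤ C' ∧ ∀ n k : ℕ, k < 2 ^ n →
      ∀ s ∈ Set.Icc ((k : ℝ) / 2 ^ n) ((k + 1) / 2 ^ n),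
        |x s - x (k / 2 ^ n)| ≤ C' * (2 : ℝ) ^ (-α * n) := by
  set q : ℝ := (2 : ℝ) ^ (-α) with hq
  have hq0 : 0 < q := by positivity
  have hq1 : q < 1 := Real.rpow_lt_one_of_one_lt_of_neg (by norm_num) (by linarith)
  have hqn (n : ℕ) : (2 : ℝ) ^ (-α * n) = q ^ n := by
    rw [hq, Real.rpow_mul (by norm_num), Real.rpow_natCast]
  simp only [hqn] at h ⊢
  have step (r : ℕ) : ∀ n k j : ℕ, k < 2 ^ n → j ≤ 2 ^ r →
      |x ((k + j / 2 ^ r) / 2 ^ n) - x (k / 2 ^ n)| ≤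
        C * q ^ n * (1 + ∑ i ∈ Finset.range r, q ^ (i + 1)) := by
    induction r with
    | zero =>
      intro n k j hk hj
      have hn : 0 ≤ C * q ^ n := by positivity
      interval_cases j
      · simpa using hn
      · simpa using h n k hk
    | succ r ih =>
      intro n k j hk hj
      rcases Nat.even_or_odd' j with ⟨i, rfl | rfl⟩
      · have hi : i ≤ 2 ^ r := by rw [pow_succ] at hj; omega
        have e : ((2 * i : ℕ) : ℝ) / 2 ^ (r + 1) = i / 2 ^ r := by
          push_cast; rw [pow_succ]; field_simp
        rw [e]
        refine (ih n k i hk hi).trans ?_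
        rw [Finset.sum_range_succ]
        have : 0 ≤ q ^ (r + 1) := by positivity
        have hn : 0 ≤ C * q ^ n := by positivity
        exact mul_le_mul_of_nonneg_left (by linarith) hn
      · have hi : i + 1 ≤ 2 ^ r := by rw [pow_succ] at hj; omega
        have h1 := ih n k i hk (by omega)
        have hlt : k * 2 ^ (r + 1) + 2 * i < 2 ^ (n + (r + 1)) := by
          have : (k + 1) * 2 ^ (r + 1) ≤ 2 ^ n * 2 ^ (r + 1) := Nat.mul_le_mul_right _ hk
          rw [pow_add _ n (r + 1)]
          have e2 : 2 ^ (r + 1) = 2 ^ r * 2 := pow_succ 2 r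
          nlinarith
        have h2 := h (n + (r + 1)) (k * 2 ^ (r + 1) + 2 * i) hlt
        have e1 : (((k * 2 ^ (r + 1) + 2 * i : ℕ) : ℝ)) / 2 ^ (n + (r + 1)) =
            (k + i / 2 ^ r) / 2 ^ n := by
          push_cast; rw [pow_add _ n (r + 1), pow_succ]; field_simp
        have e2 : (((k * 2 ^ (r + 1) + 2 * i : ℕ) : ℝ) + 1) / 2 ^ (n + (r + 1)) =
            (k + ((2 * i + 1 : ℕ) : ℝ) / 2 ^ (r + 1)) / 2 ^ n := by
          push_cast; rw [pow_add _ n (r + 1), pow_succ]; field_simp; ring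
        rw [e1, e2] at h2
        have h3 := abs_sub_le (x ((k + ((2 * i + 1 : ℕ) : ℝ) / 2 ^ (r + 1)) / 2 ^ n))
          (x ((k + i / 2 ^ r) / 2 ^ n)) (x (k / 2 ^ n))
        refine h3.trans ((add_le_add h2 h1).trans (le_of_eq ?_))
        rw [Finset.sum_range_succ, pow_add]; ring
  have hsum (r : ℕ) : ∑ i ∈ Finset.range r, q ^ (i + 1) ≤ 1 / (1 - q) := by
    have h1 : ∑ i ∈ Finset.range r, q ^ (i + 1) ≤ ∑ i ∈ Finset.range r, q ^ i :=
      Finset.sum_le_sum fun i _ => pow_le_pow_of_le_one hq0.le hq1.le (Nat.le_succ i)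
    have h2 := (summable_geometric_of_lt_one hq0.le hq1).sum_le_tsum (Finset.range r)
      (fun i _ => by positivity)
    rw [tsum_geometric_of_lt_one hq0.le hq1] at h2
    simpa using h1.trans h2
  have hq1' : 0 < 1 - q := by linarith
  refine ⟨C * (1 + 1 / (1 - q)), by positivity, ?_⟩
  intro n k hk s hs
  have hn : (0 : ℝ) < 2 ^ n := by positivity
  have hk' : (k : ℝ) + 1 ≤ 2 ^ n := by exact_mod_cast hk
  set a : ℝ := s * 2 ^ n - k with ha
  have ha0 : 0 ≤ a := by
    have := hs.1; rw [div_le_iff₀ hn] at this; rw [ha]; linarith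
  have ha1 : a ≤ 1 := by
    have := hs.2; rw [le_div_iff₀ hn] at this; rw [ha]; linarith
  have hs' : s = (k + a) / 2 ^ n := by rw [ha]; field_simp; ring
  have hfl (r : ℕ) : ⌊a * (2 : ℝ) ^ r⌋₊ ≤ 2 ^ r := by
    refine Nat.floor_le_of_le ?_
    push_cast
    have : (0 : ℝ) < 2 ^ r := by positivity
    nlinarith
  have lim1 : Tendsto (fun r : ℕ => (⌊a * (2 : ℝ) ^ r⌋₊ : ℝ) / 2 ^ r) atTop (nhds a) :=
    (tendsto_nat_floor_mul_div_atTop ha0).comp (tendsto_pow_atTop_atTop_of_one_lt one_lt_two)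
  have lim2 : Tendsto (fun r : ℕ => ((k : ℝ) + (⌊a * (2 : ℝ) ^ r⌋₊ : ℝ) / 2 ^ r) / 2 ^ n) atTop
      (nhds s) := by
    rw [hs']; exact (lim1.const_add _).div_const _
  have hmem (b : ℝ) (hb0 : 0 ≤ b) (hb1 : b ≤ 1) : ((k : ℝ) + b) / 2 ^ n ∈ Set.Icc (0 : ℝ) 1 := by
    refine ⟨by positivity, ?_⟩
    rw [div_le_one hn]; linarith
  have lim3 : Tendsto (fun r : ℕ => x (((k : ℝ) + (⌊a * (2 : ℝ) ^ r⌋₊ : ℝ) / 2 ^ r) / 2 ^ n)) atTop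
      (nhds (x s)) := by
    have hsI : s ∈ Set.Icc (0 : ℝ) 1 := by rw [hs']; exact hmem a ha0 ha1
    refine (hx s hsI).tendsto.comp (tendsto_nhdsWithin_iff.2 ⟨lim2, Eventually.of_forall fun r => ?_⟩)
    refine hmem _ (by positivity) ?_
    rw [div_le_one (by positivity)]
    exact_mod_cast hfl r
  refine le_of_tendsto ((lim3.sub_const _).abs) (Eventually.of_forall fun r => ?_)
  refine (step r n k _ hk (hfl r)).trans ?_
  have : 0 ≤ C * q ^ n := by positivity
  calc C * q ^ n * (1 + ∑ i ∈ Finset.range r, q ^ (i + 1)) ≤ C * q ^ n * (1 + 1 / (1 - q)) :=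
        mul_le_mul_of_nonneg_left (by linarith [hsum r]) this
    _ = _ := by ring

section fbm
variable {Ω : Type*} [MeasurableSpace Ω] {P : Measure Ω} {H : ℝ} {W : ℝ → Ω → ℝ}

lemma IsFBM.map_sum (hW : IsFBM P H W) {ι : Type*} [Fintype ι] (t c : ι → ℝ)
    (ht : ∀ i, t i ∈ Set.Icc (0 : ℝ) 1) :
    P.map (fun ω => ∑ i, c i * W (t i) ω) =
      gaussianReal 0 (Real.toNNReal (∑ i, ∑ j, c i * c j * fbmCov H (t i) (t j))) := by
  have e := (Fintype.equivFin ι).symm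
  have h := hW.2.2 (Fintype.card ι) (t ∘ e) (c ∘ e) (fun i => ht _)
  have e1 (ω : Ω) : ∑ i, (c ∘ e) i * W ((t ∘ e) i) ω = ∑ i, c i * W (t i) ω :=
    Equiv.sum_comp e (fun i => c i * W (t i) ω)
  have e2 : ∑ i, ∑ j, (c ∘ e) i * (c ∘ e) j * fbmCov H ((t ∘ e) i) ((t ∘ e) j) =
      ∑ i, ∑ j, c i * c j * fbmCov H (t i) (t j) := by
    rw [← Equiv.sum_comp e (fun i => ∑ j, c i * c j * fbmCov H (t i) (t j))]
    refine Finset.sum_congr rfl fun i _ => ?_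
    exact Equiv.sum_comp e (fun j => c (e i) * c j * fbmCov H (t (e i)) (t j))
  simp only [e1, e2] at h
  exact h

lemma fbmCov_self (hH : 0 < H) (s : ℝ) : fbmCov H s s = s ^ (2 * H) := by
  simp [fbmCov, Real.zero_rpow (by positivity : 2 * H ≠ 0)]

lemma fbmCov_comm (s t : ℝ) : fbmCov H s t = fbmCov H t s := by
  simp [fbmCov, abs_sub_comm s t, add_comm]

lemma fbmCov_nonneg (hH : 0 < H) {s t : ℝ} (hs : 0 ≤ s) (ht : 0 ≤ t) : 0 ≤ fbmCov H s t := by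
  have h1 : 0 ≤ s ^ (2 * H) := by positivity
  have h2 : 0 ≤ t ^ (2 * H) := by positivity
  rcases le_total s t with h | h
  · have : |s - t| ^ (2 * H) ≤ t ^ (2 * H) := by
      refine Real.rpow_le_rpow (abs_nonneg _) ?_ (by positivity)
      rw [abs_le]; constructor <;> linarith
    unfold fbmCov; linarith
  · have : |s - t| ^ (2 * H) ≤ s ^ (2 * H) := by
      refine Real.rpow_le_rpow (abs_nonneg _) ?_ (by positivity)
      rw [abs_le]; constructor <;> linarith
    unfold fbmCov; linarith

lemma IsFBM.map_single (hW : IsFBM P H W) (hH : 0 < H) {s : ℝ} (hs : s ∈ Set.Icc (0 : ℝ) 1) :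
    P.map (W s) = gaussianReal 0 (Real.toNNReal (s ^ (2 * H))) := by
  have h := hW.map_sum (fun _ : Unit => s) (fun _ => 1) (fun _ => hs)
  simpa [fbmCov_self hH] using h

lemma IsFBM.map_add (hW : IsFBM P H W) {s t : ℝ} (hs : s ∈ Set.Icc (0 : ℝ) 1)
    (ht : t ∈ Set.Icc (0 : ℝ) 1) (a b : ℝ) :
    P.map (fun ω => a * W s ω + b * W t ω) = gaussianReal 0 (Real.toNNReal
      (a ^ 2 * fbmCov H s s + 2 * a * b * fbmCov H s t + b ^ 2 * fbmCov H t t)) := by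
  have h := hW.map_sum ![s, t] ![a, b] (by intro i; fin_cases i <;> simpa)
  simp only [Fin.sum_univ_two, Matrix.cons_val_zero, Matrix.cons_val_one] at h
  rw [h, fbmCov_comm t s]
  congr 2
  ring

lemma IsFBM.integral_mul (hW : IsFBM P H W) (hH : 0 < H) {s t : ℝ} (hs : s ∈ Set.Icc (0 : ℝ) 1)
    (ht : t ∈ Set.Icc (0 : ℝ) 1) :
    Integrable (fun ω => W s ω * W t ω) P ∧ ∫ ω, W s ω * W t ω ∂P = fbmCov H s t := by
  have hms := hW.1 s
  have hmt := hW.1 t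
  have h := hW.map_add hs ht 1 1
  simp only [one_mul] at h
  have hm : Measurable (fun ω => W s ω + W t ω) := by fun_prop
  have i1 := integrable_pow_of_map_eq_gaussianReal hm h 2
  have e1 := integral_sq_of_map_eq_gaussianReal hm.aemeasurable h
  have h2 := hW.map_single hH hs
  have h3 := hW.map_single hH ht
  have i2 := integrable_pow_of_map_eq_gaussianReal hms h2 2
  have e2 := integral_sq_of_map_eq_gaussianReal hms.aemeasurable h2
  have i3 := integrable_pow_of_map_eq_gaussianReal hmt h3 2
  have e3 := integral_sq_of_map_eq_gaussianReal hmt.aemeasurable h3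
  have hs0 : 0 ≤ s ^ (2 * H) := Real.rpow_nonneg hs.1 _
  have ht0 : 0 ≤ t ^ (2 * H) := Real.rpow_nonneg ht.1 _
  rw [Real.coe_toNNReal _ hs0] at e2
  rw [Real.coe_toNNReal _ ht0] at e3
  have hc := fbmCov_nonneg hH hs.1 ht.1
  rw [fbmCov_self hH, fbmCov_self hH, Real.coe_toNNReal _ (by nlinarith)] at e1
  have e : (fun ω => W s ω * W t ω) =
      fun ω => (1 / 2 : ℝ) * ((W s ω + W t ω) ^ 2 - (W s ω ^ 2 + W t ω ^ 2)) := by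
    funext ω; ring
  have j := i2.fun_add i3
  rw [e]
  refine ⟨(i1.sub j).const_mul _, ?_⟩
  rw [integral_const_mul, integral_sub i1 j, integral_add i2 i3, e1, e2, e3]
  ring

lemma IsFBM.quadForm_nonneg (hW : IsFBM P H W) (hH : 0 < H) {ι : Type*} [Fintype ι] (t c : ι → ℝ)
    (ht : ∀ i, t i ∈ Set.Icc (0 : ℝ) 1) :
    0 ≤ ∑ i, ∑ j, c i * c j * fbmCov H (t i) (t j) := by
  have h : ∫ ω, (∑ i, c i * W (t i) ω) ^ 2 ∂P =
      ∑ i, ∑ j, c i * c j * fbmCov H (t i) (t j) := by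
    have e (ω : Ω) : (∑ i, c i * W (t i) ω) ^ 2 =
        ∑ i, ∑ j, c i * c j * (W (t i) ω * W (t j) ω) := by
      rw [sq, Finset.sum_mul_sum]
      refine Finset.sum_congr rfl fun i _ => Finset.sum_congr rfl fun j _ => by ring
    simp only [e]
    rw [integral_finsetSum _ fun i _ => integrable_finsetSum _ fun j _ =>
      (hW.integral_mul hH (ht i) (ht j)).1.const_mul _]
    refine Finset.sum_congr rfl fun i _ => ?_
    rw [integral_finsetSum _ fun j _ => (hW.integral_mul hH (ht i) (ht j)).1.const_mul _]
    refine Finset.sum_congr rfl fun j _ => ?_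
    rw [integral_const_mul, (hW.integral_mul hH (ht i) (ht j)).2]
  rw [← h]
  exact integral_nonneg fun ω => sq_nonneg _

lemma IsFBM.isGaussPair (hW : IsFBM P H W) (hH : 0 < H) {ι κ : Type*} [Fintype ι] [Fintype κ]
    (t c : ι → ℝ) (u d : κ → ℝ) (ht : ∀ i, t i ∈ Set.Icc (0 : ℝ) 1)
    (hu : ∀ i, u i ∈ Set.Icc (0 : ℝ) 1) :
    IsGaussPair P (fun ω => ∑ i, c i * W (t i) ω) (fun ω => ∑ i, d i * W (u i) ω)
      (∑ i, ∑ j, c i * c j * fbmCov H (t i) (t j)) (∑ i, ∑ j, c i * d j * fbmCov H (t i) (u j))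
      (∑ i, ∑ j, d i * d j * fbmCov H (u i) (u j)) := by
  intro x y
  have htu : ∀ i, Sum.elim t u i ∈ Set.Icc (0 : ℝ) 1 := by
    rintro (i | i)
    · exact ht i
    · exact hu i
  have h1 := hW.map_sum (Sum.elim t u) (Sum.elim (fun i => x * c i) (fun i => y * d i)) htu
  have h2 := hW.quadForm_nonneg hH (Sum.elim t u) (Sum.elim (fun i => x * c i) (fun i => y * d i)) htu
  have h3 : (fun ω => ∑ i, Sum.elim (fun i => x * c i) (fun i => y * d i) i *
      W (Sum.elim t u i) ω) =
      fun ω => x * ∑ i, c i * W (t i) ω + y * ∑ i, d i * W (u i) ω := by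
    funext ω
    simp [Finset.mul_sum, mul_assoc]
  rw [h3] at h1
  refine ⟨_, ?_, h1⟩
  rw [Real.coe_toNNReal _ h2]
  simp only [Fintype.sum_sum_type, Sum.elim_inl, Sum.elim_inr, Finset.sum_add_distrib,
    Finset.mul_sum]
  have hc : ∑ i, ∑ j, y * d i * (x * c j) * fbmCov H (u i) (t j) =
      ∑ i, ∑ j, x * y * (c i * d j * fbmCov H (t i) (u j)) := by
    rw [Finset.sum_comm]
    refine Finset.sum_congr rfl fun i _ => Finset.sum_congr rfl fun j _ => ?_
    rw [fbmCov_comm]; ring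
  rw [hc]
  have e1 : ∑ i, ∑ j, x * c i * (y * d j) * fbmCov H (t i) (u j) =
      ∑ i, ∑ j, x * y * (c i * d j * fbmCov H (t i) (u j)) :=
    Finset.sum_congr rfl fun i _ => Finset.sum_congr rfl fun j _ => by ring
  have e2 : ∑ i, ∑ j, 2 * x * y * (c i * d j * fbmCov H (t i) (u j)) =
      2 * ∑ i, ∑ j, x * y * (c i * d j * fbmCov H (t i) (u j)) := by
    simp only [Finset.mul_sum]
    exact Finset.sum_congr rfl fun i _ => Finset.sum_congr rfl fun j _ => by ring
  have e3 : ∑ i, ∑ j, x * c i * (x * c j) * fbmCov H (t i) (t j) =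
      ∑ i, ∑ j, x ^ 2 * (c i * c j * fbmCov H (t i) (t j)) :=
    Finset.sum_congr rfl fun i _ => Finset.sum_congr rfl fun j _ => by ring
  have e4 : ∑ i, ∑ j, y * d i * (y * d j) * fbmCov H (u i) (u j) =
      ∑ i, ∑ j, y ^ 2 * (d i * d j * fbmCov H (u i) (u j)) :=
    Finset.sum_congr rfl fun i _ => Finset.sum_congr rfl fun j _ => by ring
  rw [e1, e2, e3, e4]; ring

/-- Paths of fractional Brownian motion are almost surely Hölder of any order below `H`
on dyadic intervals. -/
lemma IsFBM.ae_holder (hW : IsFBM P H W) (hH : 0 < H) {α : ℝ} (hα0 : 0 < α)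
    (hα : α < H) :
    ∀ᵐ ω ∂P, ∃ C : ℝ, 0 ≤ C ∧ ∀ n k : ℕ, k < 2 ^ n →
      ∀ s ∈ Set.Icc ((k : ℝ) / 2 ^ n) ((k + 1) / 2 ^ n),
        |W s ω - W (k / 2 ^ n) ω| ≤ C * (2 : ℝ) ^ (-α * n) := by
  obtain ⟨p, hp⟩ := exists_nat_gt (1 / (2 * (H - α)))
  have hHα : 0 < H - α := by linarith
  have hp1 : 1 < 2 * (H - α) * p := by
    rw [div_lt_iff₀ (by positivity)] at hp; linarith
  have hp0 : 1 ≤ p := by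
    rcases Nat.eq_zero_or_pos p with rfl | h
    · norm_num at hp1
    · exact h
  set m : ℝ := ∫ x, x ^ (2 * p) ∂(gaussianReal 0 1) with hm
  have hm0 : 0 ≤ m := integral_nonneg fun x => by
    rw [pow_mul]; positivity
  have hmem (n k : ℕ) (hk : k ≤ 2 ^ n) : (k : ℝ) / 2 ^ n ∈ Set.Icc (0 : ℝ) 1 := by
    refine ⟨by positivity, ?_⟩
    rw [div_le_one (by positivity)]; exact_mod_cast hk
  set D : ℕ → ℕ → Ω → ℝ := fun n k ω => W ((k + 1) / 2 ^ n) ω - W (k / 2 ^ n) ω with hD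
  have hDm (n k) : Measurable (D n k) := (hW.1 _).sub (hW.1 _)
  have hlaw (n k : ℕ) (hk : k < 2 ^ n) :
      Integrable (fun ω => D n k ω ^ (2 * p)) P ∧
      ∫ ω, D n k ω ^ (2 * p) ∂P = (2 : ℝ) ^ (-(2 * H * p) * n) * m := by
    have h1 := hmem n k hk.le
    have h2 := hmem n (k + 1) hk
    push_cast at h2
    have h := hW.map_add h2 h1 1 (-1)
    have e : (1 : ℝ) ^ 2 * fbmCov H ((k + 1) / 2 ^ n) ((k + 1) / 2 ^ n) +
        2 * 1 * (-1) * fbmCov H ((k + 1) / 2 ^ n) (k / 2 ^ n) +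
        (-1) ^ 2 * fbmCov H (k / 2 ^ n) (k / 2 ^ n) = (2 : ℝ) ^ (-(2 * H) * n) := by
      rw [fbmCov_self hH, fbmCov_self hH, fbmCov]
      have : ((k : ℝ) + 1) / 2 ^ n - k / 2 ^ n = 2 ^ (-(n : ℝ)) := by
        rw [Real.rpow_neg (by norm_num), Real.rpow_natCast]; field_simp; ring
      rw [this, abs_of_pos (by positivity), ← Real.rpow_mul (by norm_num)]
      rw [show -(n : ℝ) * (2 * H) = -(2 * H) * n by ring]
      ring
    rw [e] at h
    have hD' : (fun ω => 1 * W (((k : ℝ) + 1) / 2 ^ n) ω + -1 * W (k / 2 ^ n) ω) = D n k := by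
      funext ω; simp [hD]; ring
    rw [hD'] at h
    refine ⟨integrable_pow_of_map_eq_gaussianReal (hDm n k) h _, ?_⟩
    have h3 : ∫ x, x ^ (2 * p) ∂(P.map (D n k)) = ∫ ω, D n k ω ^ (2 * p) ∂P :=
      integral_map (hDm n k).aemeasurable (by fun_prop)
    rw [← h3, h, integral_even_pow_gaussianReal, Real.coe_toNNReal _ (by positivity),
      ← Real.rpow_mul_natCast (by norm_num)]
    congr 2; ring
  set f : ℕ → Ω → ℝ := fun n ω =>
    ∑ k ∈ Finset.range (2 ^ n), ((2 : ℝ) ^ (α * n) * D n k ω) ^ (2 * p) with hf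
  have hpos (y : ℝ) : 0 ≤ y ^ (2 * p) := by rw [pow_mul]; positivity
  set b : ℕ → ℝ := fun n => m * ((2 : ℝ) ^ (1 - 2 * (H - α) * p)) ^ n with hb
  have key := ae_bdd_of_summable (P := P) f
    (fun n => (Finset.measurable_sum _ fun k _ =>
      ((hDm n k).const_mul _).pow_const _).aemeasurable) b
    ((summable_geometric_of_lt_one (by positivity)
      (Real.rpow_lt_one_of_one_lt_of_neg (by norm_num) (by linarith))).mul_left m)
    (fun n => by positivity) (fun n => by
      rw [← ofReal_integral_eq_lintegral_ofReal]
      · refine ENNReal.ofReal_le_ofReal (le_of_eq ?_)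
        simp only [hf, mul_pow]
        rw [integral_finsetSum _ fun k hk =>
          ((hlaw n k (Finset.mem_range.1 hk)).1.const_mul _)]
        rw [Finset.sum_congr rfl fun k hk => by
          rw [integral_const_mul, (hlaw n k (Finset.mem_range.1 hk)).2]]
        rw [Finset.sum_const, Finset.card_range, nsmul_eq_mul, hb]
        push_cast
        simp only [← Real.rpow_natCast]
        rw [← Real.rpow_mul (by norm_num), ← Real.rpow_mul (by norm_num)]
        rw [show (2 : ℝ) ^ (n : ℝ) * ((2 : ℝ) ^ (α * n * ((2 * p : ℕ) : ℝ)) *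
          ((2 : ℝ) ^ (-(2 * H * p) * n) * m)) = m * ((2 : ℝ) ^ (n : ℝ) *
          (2 : ℝ) ^ (α * n * ((2 * p : ℕ) : ℝ)) * (2 : ℝ) ^ (-(2 * H * p) * n)) by ring]
        rw [← Real.rpow_add (by norm_num), ← Real.rpow_add (by norm_num)]
        congr 2
        push_cast
        ring
      · simp only [hf, mul_pow]
        exact integrable_finsetSum _ fun k hk =>
          ((hlaw n k (Finset.mem_range.1 hk)).1.const_mul _)
      · exact Eventually.of_forall fun ω => Finset.sum_nonneg fun k _ => hpos _)
  filter_upwards [key, hW.2.1] with ω ⟨C, hC0, hC⟩ hcont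
  refine dyadic_holder hcont hα0 (C := 1 + C) (by linarith) fun n k hk => ?_
  have h1 : ((2 : ℝ) ^ (α * n) * D n k ω) ^ (2 * p) ≤ C :=
    (Finset.single_le_sum (f := fun k => ((2 : ℝ) ^ (α * n) * D n k ω) ^ (2 * p))
      (fun k _ => hpos _) (Finset.mem_range.2 hk)).trans (hC n)
  have h2 : |(2 : ℝ) ^ (α * n) * D n k ω| ≤ 1 + C := by
    by_contra! hcon
    have h3 : 1 ≤ |(2 : ℝ) ^ (α * n) * D n k ω| := by linarith
    have h4 : |(2 : ℝ) ^ (α * n) * D n k ω| ≤ |(2 : ℝ) ^ (α * n) * D n k ω| ^ (2 * p) :=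
      le_self_pow₀ h3 (by omega)
    rw [← abs_pow, abs_of_nonneg (hpos _)] at h4
    linarith
  rw [abs_mul, abs_of_pos (by positivity)] at h2
  rw [neg_mul, Real.rpow_neg (by norm_num), ← div_eq_mul_inv, le_div_iff₀ (by positivity)]
  simpa [hD, mul_comm] using h2

end fbm

section riemann

lemma abs_riemann_sum_sub_integral_le {f : ℝ → ℝ} (hf : IntervalIntegrable f volume 0 1) {m : ℕ}
    (hm : 0 < m) {ε : ℝ}
    (h : ∀ i < m, ∀ u ∈ Set.Icc ((i : ℝ) / m) ((i + 1) / m), |f u - f (i / m)| ≤ ε) :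
    |1 / m * ∑ i ∈ Finset.range m, f (i / m) - ∫ u in (0 : ℝ)..1, f u| ≤ ε := by
  have hm' : (0 : ℝ) < m := by exact_mod_cast hm
  have hsub (i : ℕ) (hi : i < m) :
      IntervalIntegrable f volume ((i : ℝ) / m) (((i + 1 : ℕ) : ℝ) / m) := by
    refine hf.mono_set ?_
    have h1 : (i : ℝ) + 1 ≤ m := by exact_mod_cast hi
    rw [Set.uIcc_of_le (by push_cast; gcongr; linarith), Set.uIcc_of_le (by norm_num)]
    refine Set.Icc_subset_Icc (by positivity) ?_
    push_cast
    rw [div_le_one hm']; exact h1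
  have hs := intervalIntegral.sum_integral_adjacent_intervals (μ := volume) (f := f)
    (a := fun i : ℕ => (i : ℝ) / m) (n := m) hsub
  simp only [Nat.cast_zero, zero_div, div_self hm'.ne'] at hs
  rw [← hs, Finset.mul_sum, ← Finset.sum_sub_distrib]
  refine (Finset.abs_sum_le_sum_abs _ _).trans ?_
  have hterm : ∀ i ∈ Finset.range m, |1 / m * f (i / m) -
      ∫ u in ((i : ℝ) / m)..(((i + 1 : ℕ) : ℝ) / m), f u| ≤ ε * (1 / m) := by
    intro i hi
    have hi' := Finset.mem_range.1 hi
    have e : 1 / m * f (i / m) - ∫ u in ((i : ℝ) / m)..(((i + 1 : ℕ) : ℝ) / m), f u =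
        -∫ u in ((i : ℝ) / m)..(((i + 1 : ℕ) : ℝ) / m), (f u - f (i / m)) := by
      rw [intervalIntegral.integral_sub (hsub i hi') intervalIntegrable_const,
        intervalIntegral.integral_const]
      have : ((i + 1 : ℕ) : ℝ) / m - i / m = 1 / m := by push_cast; field_simp; ring
      rw [this, smul_eq_mul]; ring
    rw [e, abs_neg, ← Real.norm_eq_abs]
    have hle : (i : ℝ) / m ≤ ((i + 1 : ℕ) : ℝ) / m := by push_cast; gcongr; linarith
    refine (intervalIntegral.norm_integral_le_of_norm_le_const (C := ε) fun u hu => ?_).trans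
      (le_of_eq ?_)
    · rw [Set.uIoc_of_le hle] at hu
      rw [Real.norm_eq_abs]
      refine h i hi' u ⟨hu.1.le, ?_⟩
      have := hu.2
      push_cast at this
      exact this
    · have : ((i + 1 : ℕ) : ℝ) / m - i / m = 1 / m := by push_cast; field_simp; ring
      rw [this, abs_of_pos (by positivity)]
  refine (Finset.sum_le_sum hterm).trans (le_of_eq ?_)
  rw [Finset.sum_const, Finset.card_range, nsmul_eq_mul]
  field_simp

lemma div_mem_Icc_of_lt {i m : ℕ} (hi : i < m) {u : ℝ}
    (hu : u ∈ Set.Icc ((i : ℝ) / m) ((i + 1) / m)) :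
    (i : ℝ) / m ∈ Set.Icc (0 : ℝ) 1 ∧ u ∈ Set.Icc (0 : ℝ) 1 ∧ |u - i / m| ≤ 1 / m := by
  have hm' : (0 : ℝ) < m := by exact_mod_cast (Nat.zero_le i).trans_lt hi
  have h1 : (i : ℝ) + 1 ≤ m := by exact_mod_cast hi
  have h0 : (0 : ℝ) ≤ i / m := by positivity
  have h2 : ((i : ℝ) + 1) / m ≤ 1 := by rw [div_le_one hm']; exact h1
  have h3 : ((i : ℝ) + 1) / m = i / m + 1 / m := by ring
  refine ⟨⟨h0, hu.1.trans (hu.2.trans h2)⟩, ⟨h0.trans hu.1, hu.2.trans h2⟩, ?_⟩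
  rw [abs_of_nonneg (by linarith [hu.1])]
  linarith [hu.2]

lemma tendsto_riemann_sum {f : ℝ → ℝ} (hf : ContinuousOn f (Set.Icc 0 1)) :
    Tendsto (fun m : ℕ => 1 / (m : ℝ) * ∑ i ∈ Finset.range m, f (i / m)) atTop
      (nhds (∫ u in (0 : ℝ)..1, f u)) := by
  have hint : IntervalIntegrable f volume 0 1 :=
    ContinuousOn.intervalIntegrable (by rwa [Set.uIcc_of_le zero_le_one])
  have huc := isCompact_Icc.uniformContinuousOn_of_continuous hf
  rw [Metric.uniformContinuousOn_iff_le] at huc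
  rw [Metric.tendsto_atTop]
  intro ε hε
  obtain ⟨δ, hδ, h⟩ := huc (ε / 2) (by positivity)
  obtain ⟨N, hN⟩ := exists_nat_one_div_lt hδ
  refine ⟨N + 1, fun m hm => ?_⟩
  rw [Real.dist_eq]
  refine (abs_riemann_sum_sub_integral_le hint (by omega) (ε := ε / 2) ?_).trans_lt (by linarith)
  intro i hi u hu
  obtain ⟨h1, h2, h3⟩ := div_mem_Icc_of_lt hi hu
  refine h u h2 _ h1 (h3.trans (le_trans ?_ hN.le))
  have : ((N : ℝ) + 1) ≤ m := by exact_mod_cast hm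
  gcongr

lemma tendsto_double_riemann_sum {q : ℝ → ℝ} (hq : Continuous q) :
    Tendsto (fun m : ℕ => 1 / (m : ℝ) * ∑ i ∈ Finset.range m,
      (1 / (m : ℝ) * ∑ j ∈ Finset.range m, q (i / m - j / m))) atTop
      (nhds (∫ u in (0 : ℝ)..1, ∫ v in (0 : ℝ)..1, q (u - v))) := by
  have hF : Continuous fun u : ℝ => ∫ v in (0 : ℝ)..1, q (u - v) :=
    intervalIntegral.continuous_parametric_intervalIntegral_of_continuous' (by fun_prop) 0 1
  have h1 := tendsto_riemann_sum hF.continuousOn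
  have huc := isCompact_Icc.uniformContinuousOn_of_continuous
    (hq.continuousOn (s := Set.Icc (-1 : ℝ) 1))
  rw [Metric.uniformContinuousOn_iff_le] at huc
  have h2 : Tendsto (fun m : ℕ => 1 / (m : ℝ) * ∑ i ∈ Finset.range m,
      (1 / (m : ℝ) * ∑ j ∈ Finset.range m, q (i / m - j / m)) - 1 / (m : ℝ) *
      ∑ i ∈ Finset.range m, ∫ v in (0 : ℝ)..1, q (i / m - v)) atTop (nhds 0) := by
    rw [Metric.tendsto_atTop]
    intro ε hε
    obtain ⟨δ, hδ, h⟩ := huc (ε / 2) (by positivity)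
    obtain ⟨N, hN⟩ := exists_nat_one_div_lt hδ
    refine ⟨N + 1, fun m hm => ?_⟩
    have hm' : (0 : ℝ) < m := by exact_mod_cast (by omega : 0 < m)
    rw [Real.dist_eq, sub_zero, ← mul_sub, ← Finset.sum_sub_distrib, abs_mul,
      abs_of_pos (by positivity)]
    have hterm : ∀ i ∈ Finset.range m, |1 / (m : ℝ) * ∑ j ∈ Finset.range m, q (i / m - j / m) -
        ∫ v in (0 : ℝ)..1, q (i / m - v)| ≤ ε / 2 := by
      intro i hi
      have hi' := Finset.mem_range.1 hi
      obtain ⟨k1, -, -⟩ := div_mem_Icc_of_lt hi' (u := i / m) ⟨le_rfl, by gcongr; linarith⟩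
      refine abs_riemann_sum_sub_integral_le (f := fun v => q (i / m - v))
        (Continuous.intervalIntegrable (by fun_prop) _ _) (by omega) (ε := ε / 2) ?_
      intro j hj u hu
      obtain ⟨l1, l2, l3⟩ := div_mem_Icc_of_lt hj hu
      refine h _ ⟨by linarith [k1.1, l2.2], by linarith [k1.2, l2.1]⟩ _
        ⟨by linarith [k1.1, l1.2], by linarith [k1.2, l1.1]⟩ ?_
      rw [Real.dist_eq, show (i : ℝ) / m - u - (i / m - j / m) = -(u - j / m) by ring, abs_neg]
      refine l3.trans (le_trans ?_ hN.le)
      have : ((N : ℝ) + 1) ≤ m := by exact_mod_cast hm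
      gcongr
    calc 1 / (m : ℝ) * |∑ i ∈ Finset.range m, (1 / (m : ℝ) * ∑ j ∈ Finset.range m, q (i / m - j / m) -
        ∫ v in (0 : ℝ)..1, q (i / m - v))| ≤ 1 / (m : ℝ) * (m * (ε / 2)) := by
          refine mul_le_mul_of_nonneg_left ?_ (by positivity)
          refine (Finset.abs_sum_le_sum_abs _ _).trans ((Finset.sum_le_sum hterm).trans ?_)
          simp
      _ < ε := by field_simp; linarith
  have h3 := h2.add h1
  simpa using h3

end riemann

section kernel

/-- The covariance kernel of the second-order wavelet increments of fractional Brownian motion. -/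
noncomputable def waveKernel (H x : ℝ) : ℝ :=
  -(1 / 2) * (4 * |x| ^ (2 * H) - |x + 1| ^ (2 * H) - |x - 1| ^ (2 * H)
    - 2 * |x + 2| ^ (2 * H) - 2 * |x - 2| ^ (2 * H) + |x + 3| ^ (2 * H) + |x - 3| ^ (2 * H))

/-- The variance of the normalised wavelet coefficients of integrated fractional Brownian motion. -/
noncomputable def waveVar (H : ℝ) : ℝ :=
  (4 * (3 : ℝ) ^ (2 * H + 2) - 4 - 4 * (2 : ℝ) ^ (2 * H + 2) - (4 : ℝ) ^ (2 * H + 2)) /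
    ((2 * H + 1) * (2 * H + 2))

lemma continuous_waveKernel {H : ℝ} (hH : 0 < H) : Continuous (waveKernel H) := by
  have h (c : ℝ) : Continuous fun x : ℝ => |x + c| ^ (2 * H) :=
    Continuous.rpow_const (by fun_prop) fun x => Or.inr (by positivity)
  have h' (c : ℝ) : Continuous fun x : ℝ => |x - c| ^ (2 * H) := by
    simpa only [← sub_eq_add_neg] using h (-c)
  have h0 : Continuous fun x : ℝ => |x| ^ (2 * H) := by simpa using h 0
  have h1 := h 1
  have h2 := h 2
  have h3 := h 3
  have k1 := h' 1
  have k2 := h' 2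
  have k3 := h' 3
  unfold waveKernel
  fun_prop

lemma waveKernel_neg (H x : ℝ) : waveKernel H (-x) = waveKernel H x := by
  have h (c : ℝ) : |-x + c| = |x - c| := by rw [← abs_neg]; congr 1; ring
  have h' (c : ℝ) : |-x - c| = |x + c| := by rw [← abs_neg]; congr 1; ring
  simp only [waveKernel, h, h', abs_neg]
  ring

lemma hasDerivAt_mul_abs_rpow {p : ℝ} (hp : 0 < p) (x : ℝ) :
    HasDerivAt (fun x : ℝ => x * |x| ^ p) ((p + 1) * |x| ^ p) x := by
  have hpos (y : ℝ) (hy : 0 < y) : HasDerivAt (fun x : ℝ => x * |x| ^ p) ((p + 1) * |y| ^ p) y := by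
    have h1 := Real.hasDerivAt_rpow_const (x := y) (p := p + 1) (Or.inl hy.ne')
    have h2 : (fun x : ℝ => x ^ (p + 1)) =ᶠ[nhds y] fun x => x * |x| ^ p := by
      filter_upwards [lt_mem_nhds hy] with z hz
      rw [abs_of_pos hz, Real.rpow_add_one hz.ne', mul_comm]
    have h3 := h1.congr_of_eventuallyEq h2.symm
    simpa [abs_of_pos hy] using h3
  rcases lt_trichotomy x 0 with hx | rfl | hx
  · have h1 := ((hpos (-x) (by linarith)).comp x (hasDerivAt_neg x)).neg
    refine (h1.congr_of_eventuallyEq (Eventually.of_forall fun z => ?_)).congr_deriv ?_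
    · simp
    · simp
  · rw [hasDerivAt_iff_tendsto_slope_zero]
    have h1 : Tendsto (fun t : ℝ => |t| ^ p) (nhdsWithin 0 {0}ᶜ) (nhds ((p + 1) * |(0 : ℝ)| ^ p)) := by
      have : Continuous fun t : ℝ => |t| ^ p :=
        Continuous.rpow_const (by fun_prop) fun x => Or.inr hp.le
      have h2 := this.tendsto 0
      simp only [abs_zero, Real.zero_rpow hp.ne', mul_zero] at h2 ⊢
      exact h2.mono_left nhdsWithin_le_nhds
    refine h1.congr' ?_
    filter_upwards [self_mem_nhdsWithin] with t ht
    have : t ≠ 0 := ht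
    simp
    field_simp
  · exact hpos x hx

lemma integral_integral_abs_rpow {p : ℝ} (hp : 0 < p) (d : ℝ) :
    ∫ u in (0 : ℝ)..1, ∫ v in (0 : ℝ)..1, |u - v + d| ^ p =
      (|d + 1| ^ (p + 2) - 2 * |d| ^ (p + 2) + |d - 1| ^ (p + 2)) / ((p + 1) * (p + 2)) := by
  have hc : Continuous fun t : ℝ => |t| ^ p :=
    Continuous.rpow_const (by fun_prop) fun x => Or.inr hp.le
  have hp1 : p + 1 ≠ 0 := by positivity
  have hp2 : p + 2 ≠ 0 := by positivity
  have inner (u : ℝ) : ∫ v in (0 : ℝ)..1, |u - v + d| ^ p =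
      ((u + d) * |u + d| ^ p - (u + (d - 1)) * |u + (d - 1)| ^ p) / (p + 1) := by
    rw [intervalIntegral.integral_eq_sub_of_hasDerivAt
      (f := fun v => -((u - v + d) * |u - v + d| ^ p) / (p + 1))]
    · rw [show u - 1 + d = u + (d - 1) by ring, sub_zero]; ring
    · intro v _
      have h1 : HasDerivAt (fun v : ℝ => u - v + d) (-1) v :=
        ((hasDerivAt_id' v).const_sub u).add_const d
      have h2 := (((hasDerivAt_mul_abs_rpow hp (u - v + d)).comp v h1).neg).div_const (p + 1)
      refine h2.congr_deriv ?_
      field_simp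
    · exact (hc.comp (by fun_prop)).intervalIntegrable _ _
  simp only [inner]
  have outer (c : ℝ) : ∫ u in (0 : ℝ)..1, (u + c) * |u + c| ^ p =
      (|c + 1| ^ (p + 2) - |c| ^ (p + 2)) / (p + 2) := by
    rw [intervalIntegral.integral_eq_sub_of_hasDerivAt
      (f := fun u => |u + c| ^ (p + 2) / (p + 2))]
    · rw [zero_add, add_comm 1 c]; ring
    · intro u _
      have h1 : HasDerivAt (fun v : ℝ => v + c) 1 u := (hasDerivAt_id' u).add_const c
      have h2 := ((hasDerivAt_abs_rpow (u + c) (p := p + 2) (by linarith)).comp u h1).div_const (p + 2)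
      refine h2.congr_deriv ?_
      rw [show p + 2 - 2 = p by ring]
      field_simp
    · exact (Continuous.mul (by fun_prop) (hc.comp (by fun_prop))).intervalIntegrable _ _
  have hi (c : ℝ) : IntervalIntegrable (fun u : ℝ => (u + c) * |u + c| ^ p) volume 0 1 :=
    (Continuous.mul (by fun_prop) (hc.comp (by fun_prop))).intervalIntegrable _ _
  rw [intervalIntegral.integral_div, intervalIntegral.integral_sub (hi _) (hi _), outer, outer]
  rw [show d - 1 + 1 = d by ring]
  field_simp
  ring

lemma integral_integral_waveKernel {H : ℝ} (hH : 0 < H) :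
    ∫ u in (0 : ℝ)..1, ∫ v in (0 : ℝ)..1, waveKernel H (u - v) = waveVar H := by
  have hp : 0 < 2 * H := by positivity
  have hc (d : ℝ) : Continuous fun t : ℝ => |t + d| ^ (2 * H) :=
    Continuous.rpow_const (by fun_prop) fun x => Or.inr hp.le
  set J : ℝ → ℝ → ℝ := fun d u => ∫ v in (0 : ℝ)..1, |u - v + d| ^ (2 * H) with hJ
  have hJc (d : ℝ) : Continuous (J d) := by
    have h2 : Continuous (Function.uncurry fun u v : ℝ => |u - v + d| ^ (2 * H)) :=
      (hc d).comp (continuous_fst.sub continuous_snd)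
    exact intervalIntegral.continuous_parametric_intervalIntegral_of_continuous' h2 0 1
  have hJi (d : ℝ) : IntervalIntegrable (J d) volume 0 1 := (hJc d).intervalIntegrable _ _
  have hI (d u : ℝ) : IntervalIntegrable (fun v => |u - v + d| ^ (2 * H)) volume 0 1 :=
    ((hc d).comp (by fun_prop : Continuous fun v : ℝ => u - v)).intervalIntegrable _ _
  have inner (u : ℝ) : ∫ v in (0 : ℝ)..1, waveKernel H (u - v) =
      -(1 / 2) * (4 * J 0 u - J 1 u - J (-1) u - 2 * J 2 u - 2 * J (-2) u + J 3 u + J (-3) u) := by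
    have e (v : ℝ) : waveKernel H (u - v) = -(1 / 2) * (4 * |u - v + 0| ^ (2 * H) -
        |u - v + 1| ^ (2 * H) - |u - v + -1| ^ (2 * H) - 2 * |u - v + 2| ^ (2 * H) -
        2 * |u - v + -2| ^ (2 * H) + |u - v + 3| ^ (2 * H) + |u - v + -3| ^ (2 * H)) := by
      simp only [waveKernel, add_zero, ← sub_eq_add_neg]
    simp only [e]
    have i0 := (hI 0 u).const_mul 4
    have i2 := (hI 2 u).const_mul 2
    have i2' := (hI (-2) u).const_mul 2
    rw [intervalIntegral.integral_const_mul,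
      intervalIntegral.integral_add (((((i0.sub (hI 1 u)).sub (hI (-1) u)).sub i2).sub i2').add
        (hI 3 u)) (hI (-3) u),
      intervalIntegral.integral_add ((((i0.sub (hI 1 u)).sub (hI (-1) u)).sub i2).sub i2') (hI 3 u),
      intervalIntegral.integral_sub (((i0.sub (hI 1 u)).sub (hI (-1) u)).sub i2) i2',
      intervalIntegral.integral_sub ((i0.sub (hI 1 u)).sub (hI (-1) u)) i2,
      intervalIntegral.integral_sub (i0.sub (hI 1 u)) (hI (-1) u),
      intervalIntegral.integral_sub i0 (hI 1 u),
      intervalIntegral.integral_const_mul, intervalIntegral.integral_const_mul,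
      intervalIntegral.integral_const_mul]
  simp only [inner]
  have i0 := (hJi 0).const_mul 4
  have i2 := (hJi 2).const_mul 2
  have i2' := (hJi (-2)).const_mul 2
  rw [intervalIntegral.integral_const_mul,
    intervalIntegral.integral_add (((((i0.sub (hJi 1)).sub (hJi (-1))).sub i2).sub i2').add
      (hJi 3)) (hJi (-3)),
    intervalIntegral.integral_add ((((i0.sub (hJi 1)).sub (hJi (-1))).sub i2).sub i2') (hJi 3),
    intervalIntegral.integral_sub (((i0.sub (hJi 1)).sub (hJi (-1))).sub i2) i2',
    intervalIntegral.integral_sub ((i0.sub (hJi 1)).sub (hJi (-1))) i2,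
    intervalIntegral.integral_sub (i0.sub (hJi 1)) (hJi (-1)),
    intervalIntegral.integral_sub i0 (hJi 1),
    intervalIntegral.integral_const_mul, intervalIntegral.integral_const_mul,
    intervalIntegral.integral_const_mul]
  simp only [hJ, integral_integral_abs_rpow hp]
  norm_num
  rw [Real.zero_rpow (by positivity), waveVar]
  field_simp
  ring

lemma waveVar_pos {H : ℝ} (hH : H ∈ Set.Ioo (0 : ℝ) 1) : 0 < waveVar H := by
  obtain ⟨h0, h1⟩ := hH
  set κ := 2 * H + 2 with hκ
  have h3 : (0 : ℝ) < 3 ^ κ := by positivity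
  have hpq (a : ℝ) (ha : 0 < a) (ha1 : a ≠ 1) :
      a ^ κ < (1 - H) * a ^ (2 : ℝ) + H * a ^ (4 : ℝ) := by
    have hl : Real.log a ≠ 0 := by
      simp [Real.log_eq_zero]; refine ⟨ha.ne', ha1, by linarith⟩
    have h := strictConvexOn_exp.2 (Set.mem_univ (Real.log a * 2)) (Set.mem_univ (Real.log a * 4))
      (by intro h; apply hl; linarith) (by linarith : 0 < 1 - H) h0 (by ring)
    simp only [smul_eq_mul] at h
    rw [Real.rpow_def_of_pos ha, Real.rpow_def_of_pos ha, Real.rpow_def_of_pos ha]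
    have e : Real.log a * κ = (1 - H) * (Real.log a * 2) + H * (Real.log a * 4) := by
      rw [hκ]; ring
    rw [e]
    exact h
  have c1 := hpq (1 / 3) (by norm_num) (by norm_num)
  have c2 := hpq (2 / 3) (by norm_num) (by norm_num)
  have c3 := hpq (4 / 3) (by norm_num) (by norm_num)
  rw [Real.div_rpow (by norm_num) (by norm_num), Real.one_rpow] at c1
  rw [Real.div_rpow (by norm_num) (by norm_num)] at c2 c3
  have e2 (a : ℝ) : a ^ (2 : ℝ) = a ^ 2 := by exact_mod_cast Real.rpow_natCast a 2
  have e4 (a : ℝ) : a ^ (4 : ℝ) = a ^ 4 := by exact_mod_cast Real.rpow_natCast a 4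
  rw [e2, e4] at c1 c2 c3
  norm_num at c1 c2 c3
  have key : 4 * (1 / (3 : ℝ) ^ κ) + 4 * ((2 : ℝ) ^ κ / 3 ^ κ) + (4 : ℝ) ^ κ / 3 ^ κ < 4 := by
    norm_num
    linarith
  have key2 : 4 + 4 * (2 : ℝ) ^ κ + (4 : ℝ) ^ κ < 4 * 3 ^ κ := by
    have := mul_lt_mul_of_pos_right key h3
    field_simp at this
    linarith
  unfold waveVar
  rw [← hκ]
  refine div_pos (by linarith) (by positivity)

lemma abs_forward_diff_le {F F' : ℝ → ℝ} {a K h : ℝ} (hh : 0 ≤ h)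
    (hF : ∀ y, a ≤ y → HasDerivAt F (F' y) y) (hK : ∀ y, a ≤ y → |F' y| ≤ K) :
    ∀ y, a ≤ y → |F (y + h) - F y| ≤ K * h := by
  intro y hy
  have h1 := (convex_Ici a).norm_image_sub_le_of_norm_hasDerivWithin_le (f := F) (f' := F') (C := K)
    (fun z hz => (hF z (Set.mem_Ici.1 hz)).hasDerivWithinAt) (fun z hz => hK z (Set.mem_Ici.1 hz))
    (x := y) (y := y + h) (Set.mem_Ici.2 hy) (Set.mem_Ici.2 (by linarith))
  simpa [abs_of_nonneg hh] using h1

lemma abs_fourth_diff_rpow_le {s a : ℝ} (hs0 : 0 ≤ s) (hs2 : s ≤ 2) (ha : 1 ≤ a) :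
    |(a + 6) ^ s - 2 * (a + 5) ^ s - (a + 4) ^ s + 4 * (a + 3) ^ s - (a + 2) ^ s
      - 2 * (a + 1) ^ s + a ^ s| ≤ 48 / a ^ 2 := by
  have hd (r c : ℝ) (hc : 0 ≤ c) (y : ℝ) (hy : a ≤ y) :
      HasDerivAt (fun y : ℝ => (y + c) ^ r) (r * (y + c) ^ (r - 1)) y := by
    have h1 : HasDerivAt (fun y : ℝ => y + c) 1 y := (hasDerivAt_id' y).add_const c
    have hne : y + c ≠ 0 := by
      have : 0 < y + c := by linarith
      exact this.ne'
    have := h1.rpow_const (p := r) (Or.inl hne)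
    simpa using this
  have hd0 (r : ℝ) (y : ℝ) (hy : a ≤ y) :
      HasDerivAt (fun y : ℝ => y ^ r) (r * y ^ (r - 1)) y := by
    simpa using hd r 0 le_rfl y hy
  have ha0 : 0 < a := by linarith
  have s1 : ∀ y, a ≤ y → |(y + 1) ^ (s - 3) - y ^ (s - 3)| ≤ 3 * (1 / a ^ 2) * 1 := by
    refine abs_forward_diff_le (F := fun y => y ^ (s - 3)) zero_le_one (hd0 (s - 3)) ?_
    intro y hy
    have hy0 : 0 < y := by linarith
    rw [abs_mul, abs_of_pos (Real.rpow_pos_of_pos hy0 _)]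
    have h1 : |s - 3| ≤ 3 := by rw [abs_le]; constructor <;> linarith
    have h2 : y ^ (s - 3 - 1) ≤ 1 / a ^ 2 := by
      calc y ^ (s - 3 - 1) ≤ a ^ (s - 3 - 1) :=
            Real.rpow_le_rpow_of_nonpos ha0 hy (by linarith)
        _ ≤ a ^ (-2 : ℝ) := Real.rpow_le_rpow_of_exponent_le ha (by linarith)
        _ = 1 / a ^ 2 := by
          rw [Real.rpow_neg ha0.le, one_div]
          congr 1
          exact_mod_cast Real.rpow_natCast a 2
    exact mul_le_mul h1 h2 (by positivity) (by norm_num)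
  have s2 : ∀ y, a ≤ y → |((y + 1 + 1) ^ (s - 2) - (y + 1) ^ (s - 2)) -
      ((y + 1) ^ (s - 2) - y ^ (s - 2))| ≤ 2 * (3 * (1 / a ^ 2) * 1) * 1 := by
    refine abs_forward_diff_le (F := fun y => (y + 1) ^ (s - 2) - y ^ (s - 2))
      (F' := fun y => (s - 2) * ((y + 1) ^ (s - 3) - y ^ (s - 3))) zero_le_one ?_ ?_
    · intro y hy
      refine ((hd (s - 2) 1 zero_le_one y hy).sub (hd0 (s - 2) y hy)).congr_deriv ?_
      rw [show s - 2 - 1 = s - 3 by ring]; ring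
    · intro y hy
      rw [abs_mul]
      have h1 : |s - 2| ≤ 2 := by rw [abs_le]; constructor <;> linarith
      exact mul_le_mul h1 (s1 y hy) (abs_nonneg _) (by norm_num)
  set G : ℝ → ℝ → ℝ := fun r y => (y + 2) ^ r - 2 * (y + 1) ^ r + y ^ r with hG
  have hGd (r y : ℝ) (hy : a ≤ y) : HasDerivAt (G r) (r * G (r - 1) y) y := by
    refine (((hd r 2 (by norm_num) y hy).sub ((hd r 1 zero_le_one y hy).const_mul 2)).add
      (hd0 r y hy)).congr_deriv ?_
    simp only [hG]; ring
  have s3 : ∀ y, a ≤ y → |G (s - 1) (y + 2) - G (s - 1) y| ≤ (1 * (6 * (1 / a ^ 2))) * 2 := by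
    refine abs_forward_diff_le (by norm_num) (hGd (s - 1)) ?_
    intro y hy
    rw [abs_mul]
    have h1 : |s - 1| ≤ 1 := by rw [abs_le]; constructor <;> linarith
    refine mul_le_mul h1 ?_ (abs_nonneg _) (by norm_num)
    have h2 := s2 y hy
    simp only [hG]
    rw [show s - 1 - 1 = s - 2 by ring]
    rw [show y + 1 + 1 = y + 2 by ring] at h2
    rw [show (y + 2) ^ (s - 2) - 2 * (y + 1) ^ (s - 2) + y ^ (s - 2) =
      ((y + 2) ^ (s - 2) - (y + 1) ^ (s - 2)) - ((y + 1) ^ (s - 2) - y ^ (s - 2)) by ring]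
    linarith
  have s4 : ∀ y, a ≤ y → |(G s (y + 2 + 2) - G s (y + 2)) - (G s (y + 2) - G s y)| ≤
      (2 * ((1 * (6 * (1 / a ^ 2))) * 2)) * 2 := by
    refine abs_forward_diff_le (F := fun y => G s (y + 2) - G s y)
      (F' := fun y => s * (G (s - 1) (y + 2) - G (s - 1) y)) (by norm_num) ?_ ?_
    · intro y hy
      have h1 : HasDerivAt (fun y : ℝ => y + 2) 1 y := (hasDerivAt_id' y).add_const 2
      have h2 := (hGd s (y + 2) (by linarith)).comp y h1
      refine (h2.sub (hGd s y hy)).congr_deriv ?_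
      ring
    · intro y hy
      rw [abs_mul]
      have h1 : |s| ≤ 2 := by rw [abs_le]; constructor <;> linarith
      exact mul_le_mul h1 (s3 y hy) (abs_nonneg _) (by norm_num)
  have h := s4 a le_rfl
  simp only [hG] at h
  rw [show a + 2 + 2 + 2 = a + 6 by ring, show a + 2 + 2 + 1 = a + 5 by ring,
    show a + 2 + 2 = a + 4 by ring, show a + 2 + 1 = a + 3 by ring] at h
  refine le_trans (le_of_eq ?_) (h.trans (le_of_eq ?_))
  · congr 1; ring
  · ring

lemma abs_waveKernel_le_of_le {H : ℝ} (hH : H ∈ Set.Ioo (0 : ℝ) 1) {x : ℝ} (hx : 4 ≤ x) :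
    |waveKernel H x| ≤ 24 / (x - 3) ^ 2 := by
  have h := abs_fourth_diff_rpow_le (s := 2 * H) (a := x - 3) (by linarith [hH.1])
    (by linarith [hH.2]) (by linarith)
  have e : waveKernel H x = -(1 / 2) * ((x - 3 + 6) ^ (2 * H) - 2 * (x - 3 + 5) ^ (2 * H) -
      (x - 3 + 4) ^ (2 * H) + 4 * (x - 3 + 3) ^ (2 * H) - (x - 3 + 2) ^ (2 * H)
      - 2 * (x - 3 + 1) ^ (2 * H) + (x - 3) ^ (2 * H)) := by
    unfold waveKernel
    rw [abs_of_pos (by linarith : 0 < x), abs_of_pos (by linarith : 0 < x + 1),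
      abs_of_pos (by linarith : 0 < x - 1), abs_of_pos (by linarith : 0 < x + 2),
      abs_of_pos (by linarith : 0 < x - 2), abs_of_pos (by linarith : 0 < x + 3),
      abs_of_pos (by linarith : 0 < x - 3)]
    ring_nf
  rw [e, abs_mul, abs_neg, abs_of_pos (by norm_num : (0 : ℝ) < 1 / 2)]
  calc _ ≤ 1 / 2 * (48 / (x - 3) ^ 2) := by gcongr
    _ = _ := by ring

lemma abs_waveKernel_le {H : ℝ} (hH : H ∈ Set.Ioo (0 : ℝ) 1) (D : ℤ) {y : ℝ} (hy : |y| ≤ 1) :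
    |waveKernel H (4 * D + y)| ≤ 1024 / (1 + |(D : ℝ)|) := by
  have hy' := abs_le.1 hy
  have main (E : ℤ) (hE : 2 ≤ E) (z : ℝ) (hz : |z| ≤ 1) :
      |waveKernel H (4 * E + z)| ≤ 1024 / (1 + |(E : ℝ)|) := by
    have hE' : (2 : ℝ) ≤ E := by exact_mod_cast hE
    have hz' := abs_le.1 hz
    refine (abs_waveKernel_le_of_le hH (by linarith)).trans ?_
    rw [abs_of_pos (by linarith), div_le_div_iff₀ (by nlinarith) (by linarith)]
    nlinarith
  rcases le_or_gt 2 D with h | h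
  · exact main D h y hy
  rcases le_or_gt D (-2) with h' | h'
  · have := main (-D) (by omega) (-y) (by rwa [abs_neg])
    push_cast at this
    rw [abs_neg, show 4 * -(D : ℝ) + -y = -(4 * D + y) by ring, waveKernel_neg] at this
    exact this
  have hD1 : (D : ℝ) ≤ 1 := by exact_mod_cast (by omega : D ≤ 1)
  have hD2 : (-1 : ℝ) ≤ D := by exact_mod_cast (by omega : -1 ≤ D)
  have hDa : |(D : ℝ)| ≤ 1 := abs_le.2 ⟨hD2, hD1⟩
  have b (c : ℝ) (hc : |c| ≤ 3) : |4 * D + y + c| ^ (2 * H) ≤ 64 := by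
    have hc' := abs_le.1 hc
    calc |4 * D + y + c| ^ (2 * H) ≤ (8 : ℝ) ^ (2 * H) := by
          refine Real.rpow_le_rpow (abs_nonneg _) ?_ (by linarith [hH.1])
          rw [abs_le]; constructor <;> linarith
      _ ≤ (8 : ℝ) ^ (2 : ℝ) := Real.rpow_le_rpow_of_exponent_le (by norm_num) (by linarith [hH.2])
      _ = 64 := by norm_num
  have b' (c : ℝ) : 0 ≤ |4 * D + y + c| ^ (2 * H) := by positivity
  have b0 := b 0 (by norm_num)
  have b1 := b 1 (by norm_num)
  have b2 := b 2 (by norm_num)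
  have b3 := b 3 (by norm_num)
  have b4 := b (-1) (by norm_num)
  have b5 := b (-2) (by norm_num)
  have b6 := b (-3) (by norm_num)
  have c0 := b' 0
  have c1 := b' 1
  have c2 := b' 2
  have c3 := b' 3
  have c4 := b' (-1)
  have c5 := b' (-2)
  have c6 := b' (-3)
  simp only [add_zero, ← sub_eq_add_neg] at b0 b1 b2 b3 b4 b5 b6 c0 c1 c2 c3 c4 c5 c6
  calc |waveKernel H (4 * D + y)| ≤ 512 := by
        unfold waveKernel
        rw [abs_le]; constructor <;> linarith
    _ ≤ 1024 / (1 + |(D : ℝ)|) := by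
        rw [le_div_iff₀ (by positivity)]; linarith

end kernel

section wavelet

/-- The signs of the second-order wavelet. -/
def waveSign : Fin 4 → ℝ := ![-1, 1, 1, -1]

/-- The normalised wavelet coefficients of the primitive of `f`. -/
noncomputable def waveCoef (H : ℝ) (f : ℝ → ℝ) (n k : ℕ) : ℝ :=
  ((2 : ℝ) ^ (n + 2)) ^ H *
    ∫ u in (0 : ℝ)..1, ∑ p : Fin 4, waveSign p * f ((4 * k + (p : ℕ) + u) / 2 ^ (n + 2))

/-- Riemann sum approximation of `waveCoef`. -/
noncomputable def waveCoefApprox (H : ℝ) (f : ℝ → ℝ) (m n k : ℕ) : ℝ :=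
  ∑ i : Fin m × Fin 4, ((2 : ℝ) ^ (n + 2)) ^ H * (1 / m) * waveSign i.2 *
    f ((4 * k + ((i.2 : ℕ) : ℝ) + ((i.1 : ℕ) : ℝ) / m) / 2 ^ (n + 2))

/-- The covariances of the Riemann sum approximations. -/
noncomputable def waveCov (H : ℝ) (m : ℕ) (D : ℤ) : ℝ :=
  1 / (m : ℝ) * ∑ i ∈ Finset.range m, (1 / (m : ℝ) * ∑ j ∈ Finset.range m,
    waveKernel H (4 * D + (i / m - j / m)))

lemma mem_Icc_of_wave {n k : ℕ} (hk : k < 2 ^ n) (p : Fin 4) {u : ℝ} (hu : u ∈ Set.Icc (0 : ℝ) 1) :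
    (4 * k + ((p : ℕ) : ℝ) + u) / 2 ^ (n + 2) ∈ Set.Icc (k / 2 ^ n : ℝ) ((k + 1) / 2 ^ n) ∧
    (4 * k + ((p : ℕ) : ℝ) + u) / 2 ^ (n + 2) ∈ Set.Icc (0 : ℝ) 1 := by
  have hp : ((p : ℕ) : ℝ) ≤ 3 := by exact_mod_cast (by omega : (p : ℕ) ≤ 3)
  have hp0 : (0 : ℝ) ≤ ((p : ℕ) : ℝ) := by positivity
  have hk' : (k : ℝ) + 1 ≤ 2 ^ n := by exact_mod_cast hk
  have e : (2 : ℝ) ^ (n + 2) = 4 * 2 ^ n := by ring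
  have h0 : (0 : ℝ) < 2 ^ n := by positivity
  have h1 : (k / 2 ^ n : ℝ) ≤ (4 * k + ((p : ℕ) : ℝ) + u) / 2 ^ (n + 2) := by
    rw [e, div_le_div_iff₀ h0 (by positivity)]; nlinarith [hu.1]
  have h2 : (4 * k + ((p : ℕ) : ℝ) + u) / 2 ^ (n + 2) ≤ ((k : ℝ) + 1) / 2 ^ n := by
    rw [e, div_le_div_iff₀ (by positivity) h0]; nlinarith [hu.2]
  have h3 : ((k : ℝ) + 1) / 2 ^ n ≤ 1 := by rw [div_le_one h0]; exact hk'
  exact ⟨⟨h1, h2⟩, le_trans (by positivity) h1, h2.trans h3⟩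

lemma continuousOn_wave {f : ℝ → ℝ} (hf : ContinuousOn f (Set.Icc 0 1)) {n k : ℕ} (hk : k < 2 ^ n)
    (p : Fin 4) : ContinuousOn (fun u : ℝ => f ((4 * k + ((p : ℕ) : ℝ) + u) / 2 ^ (n + 2)))
      (Set.Icc 0 1) :=
  hf.comp (by fun_prop) fun _ hu => (mem_Icc_of_wave hk p hu).2

lemma tendsto_waveCoefApprox (H : ℝ) {f : ℝ → ℝ} (hf : ContinuousOn f (Set.Icc 0 1)) {n k : ℕ}
    (hk : k < 2 ^ n) :
    Tendsto (fun m => waveCoefApprox H f m n k) atTop (nhds (waveCoef H f n k)) := by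
  have hc : ContinuousOn (fun u : ℝ => ∑ p : Fin 4, waveSign p *
      f ((4 * k + ((p : ℕ) : ℝ) + u) / 2 ^ (n + 2))) (Set.Icc 0 1) :=
    continuousOn_finsetSum _ fun p _ => continuousOn_const.mul (continuousOn_wave hf hk p)
  refine ((tendsto_riemann_sum hc).const_mul (((2 : ℝ) ^ (n + 2)) ^ H)).congr fun m => ?_
  rw [waveCoefApprox, Fintype.sum_prod_type, Finset.mul_sum, Finset.mul_sum,
    ← Fin.sum_univ_eq_sum_range (fun i => ((2 : ℝ) ^ (n + 2)) ^ H * (1 / (m : ℝ) *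
      ∑ p : Fin 4, waveSign p * f ((4 * k + ((p : ℕ) : ℝ) + (i : ℝ) / m) / 2 ^ (n + 2))))]
  refine Finset.sum_congr rfl fun i _ => ?_
  rw [Finset.mul_sum, Finset.mul_sum]
  refine Finset.sum_congr rfl fun p _ => ?_
  ring

lemma sum_waveSign_fbmCov (H : ℝ) (n k l : ℕ) (u v : ℝ) :
    ∑ p : Fin 4, ∑ q : Fin 4, waveSign p * waveSign q * fbmCov H
      ((4 * k + ((p : ℕ) : ℝ) + u) / 2 ^ (n + 2)) ((4 * l + ((q : ℕ) : ℝ) + v) / 2 ^ (n + 2)) =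
    (((2 : ℝ) ^ (n + 2)) ^ (2 * H))⁻¹ * waveKernel H (4 * ((k : ℤ) - l : ℤ) + (u - v)) := by
  have hN : (0 : ℝ) < 2 ^ (n + 2) := by positivity
  set N : ℝ := 2 ^ (n + 2) with hNd
  have e (a b : ℝ) : |a / N - b / N| ^ (2 * H) = (N ^ (2 * H))⁻¹ * |a - b| ^ (2 * H) := by
    rw [← sub_div, abs_div, abs_of_pos hN, Real.div_rpow (abs_nonneg _) hN.le]
    ring
  set x : ℝ := 4 * ((k : ℝ) - l) + (u - v) with hx
  have d (p q : ℝ) : 4 * (k : ℝ) + p + u - (4 * l + q + v) = x + (p - q) := by rw [hx]; ring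
  simp only [fbmCov, e, d]
  set c := (N ^ (2 * H))⁻¹
  push_cast
  rw [← hx]
  have w0 : waveSign 0 = -1 := rfl
  have w1 : waveSign 1 = 1 := rfl
  have w2 : waveSign 2 = 1 := rfl
  have w3 : waveSign 3 = -1 := rfl
  simp only [Fin.sum_univ_four, w0, w1, w2, w3, waveKernel]
  norm_num
  simp only [← sub_eq_add_neg]
  ring

lemma sum_waveCoefApprox_cov (H : ℝ) (m n k l : ℕ) :
    ∑ i : Fin m × Fin 4, ∑ j : Fin m × Fin 4,
      (((2 : ℝ) ^ (n + 2)) ^ H * (1 / m) * waveSign i.2) *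
      (((2 : ℝ) ^ (n + 2)) ^ H * (1 / m) * waveSign j.2) * fbmCov H
        ((4 * k + ((i.2 : ℕ) : ℝ) + ((i.1 : ℕ) : ℝ) / m) / 2 ^ (n + 2))
        ((4 * l + ((j.2 : ℕ) : ℝ) + ((j.1 : ℕ) : ℝ) / m) / 2 ^ (n + 2)) =
      waveCov H m ((k : ℤ) - l) := by
  have hN : (0 : ℝ) < 2 ^ (n + 2) := by positivity
  have hpow : ((2 : ℝ) ^ (n + 2)) ^ (2 * H) = ((2 : ℝ) ^ (n + 2)) ^ H * ((2 : ℝ) ^ (n + 2)) ^ H := by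
    rw [← Real.rpow_add hN]; congr 1; ring
  have hN' : ((2 : ℝ) ^ (n + 2)) ^ H ≠ 0 := (Real.rpow_pos_of_pos hN _).ne'
  rw [Fintype.sum_prod_type, waveCov, Finset.mul_sum,
    ← Fin.sum_univ_eq_sum_range (fun i => 1 / (m : ℝ) * (1 / (m : ℝ) * ∑ j ∈ Finset.range m,
      waveKernel H (4 * ((k : ℤ) - l : ℤ) + ((i : ℝ) / m - j / m))))]
  refine Finset.sum_congr rfl fun i _ => ?_
  rw [← Fin.sum_univ_eq_sum_range (fun j =>
      waveKernel H (4 * ((k : ℤ) - l : ℤ) + (((i : ℕ) : ℝ) / m - (j : ℝ) / m)))]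
  simp only [Fintype.sum_prod_type]
  rw [Finset.sum_comm, Finset.mul_sum, Finset.mul_sum]
  refine Finset.sum_congr rfl fun j _ => ?_
  have h := sum_waveSign_fbmCov H n k l (((i : ℕ) : ℝ) / m) (((j : ℕ) : ℝ) / m)
  have h2 : waveKernel H (4 * ((k : ℤ) - l : ℤ) + (((i : ℕ) : ℝ) / m - ((j : ℕ) : ℝ) / m)) =
      ((2 : ℝ) ^ (n + 2)) ^ (2 * H) * ∑ p : Fin 4, ∑ q : Fin 4, waveSign p * waveSign q * fbmCov H
      ((4 * k + ((p : ℕ) : ℝ) + ((i : ℕ) : ℝ) / m) / 2 ^ (n + 2))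
      ((4 * l + ((q : ℕ) : ℝ) + ((j : ℕ) : ℝ) / m) / 2 ^ (n + 2)) := by
    rw [h, hpow]; field_simp
  rw [h2, hpow, Finset.mul_sum, Finset.mul_sum, Finset.mul_sum]
  refine Finset.sum_congr rfl fun p _ => ?_
  rw [Finset.mul_sum, Finset.mul_sum, Finset.mul_sum]
  refine Finset.sum_congr rfl fun q _ => ?_
  ring

lemma tendsto_waveCov_zero {H : ℝ} (hH : 0 < H) :
    Tendsto (fun m => waveCov H m 0) atTop (nhds (waveVar H)) := by
  have h := tendsto_double_riemann_sum (continuous_waveKernel hH)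
  rw [integral_integral_waveKernel hH] at h
  simpa [waveCov] using h

lemma abs_waveCov_le {H : ℝ} (hH : H ∈ Set.Ioo (0 : ℝ) 1) (m : ℕ) (D : ℤ) :
    |waveCov H m D| ≤ 1024 / (1 + |(D : ℝ)|) := by
  have hb : (0 : ℝ) ≤ 1024 / (1 + |(D : ℝ)|) := by positivity
  have avg (F : ℕ → ℝ) (hF : ∀ i < m, |F i| ≤ 1024 / (1 + |(D : ℝ)|)) :
      |1 / (m : ℝ) * ∑ i ∈ Finset.range m, F i| ≤ 1024 / (1 + |(D : ℝ)|) := by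
    rcases Nat.eq_zero_or_pos m with rfl | hm
    · simpa using hb
    have hm' : (0 : ℝ) < m := by exact_mod_cast hm
    rw [abs_mul, abs_of_pos (by positivity)]
    calc 1 / (m : ℝ) * |∑ i ∈ Finset.range m, F i|
        ≤ 1 / (m : ℝ) * (m * (1024 / (1 + |(D : ℝ)|))) := by
          refine mul_le_mul_of_nonneg_left ?_ (by positivity)
          refine (Finset.abs_sum_le_sum_abs _ _).trans
            ((Finset.sum_le_sum fun i hi => hF i (Finset.mem_range.1 hi)).trans ?_)
          simp
      _ = _ := by field_simp
  refine avg _ fun i hi => avg _ fun j hj => abs_waveKernel_le hH D ?_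
  obtain ⟨h1, -, -⟩ := div_mem_Icc_of_lt hi (u := i / m) ⟨le_rfl, by gcongr; linarith⟩
  obtain ⟨h2, -, -⟩ := div_mem_Icc_of_lt hj (u := j / m) ⟨le_rfl, by gcongr; linarith⟩
  rw [abs_le]
  constructor <;> linarith [h1.1, h1.2, h2.1, h2.2]

lemma summable_one_div_one_add_abs_sq : Summable fun d : ℤ => (1024 / (1 + |(d : ℝ)|)) ^ 2 := by
  have h : Summable fun n : ℕ => (1024 / (1 + (n : ℝ))) ^ 2 := by
    have h1 := ((summable_nat_add_iff 1).2 (Real.summable_one_div_nat_pow.2 one_lt_two)).mul_left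
      (1024 ^ 2 : ℝ)
    refine h1.congr fun n => ?_
    push_cast
    rw [div_pow, add_comm]; ring
  refine Summable.of_nat_of_neg (by simpa using h) (by simpa using h)

lemma exists_sum_waveCov_sq_le {H : ℝ} (hH : H ∈ Set.Ioo (0 : ℝ) 1) :
    ∃ C : ℝ, 0 ≤ C ∧ ∀ (m k : ℕ) (I : Finset ℕ),
      ∑ l ∈ I, 2 * waveCov H m ((k : ℤ) - l) ^ 2 ≤ C := by
  refine ⟨2 * ∑' d : ℤ, (1024 / (1 + |(d : ℝ)|)) ^ 2, by positivity, fun m k I => ?_⟩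
  rw [← Finset.mul_sum]
  refine mul_le_mul_of_nonneg_left ?_ (by norm_num)
  have hinj : Function.Injective fun l : ℕ => (k : ℤ) - l := fun a b h => by
    simp only at h; omega
  calc ∑ l ∈ I, waveCov H m ((k : ℤ) - l) ^ 2
      = ∑ d ∈ I.map ⟨_, hinj⟩, waveCov H m d ^ 2 := by rw [Finset.sum_map]; rfl
    _ ≤ ∑ d ∈ I.map ⟨_, hinj⟩, (1024 / (1 + |(d : ℝ)|)) ^ 2 :=
        Finset.sum_le_sum fun d _ => sq_le_sq' (neg_le_of_abs_le (abs_waveCov_le hH m d))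
          (le_of_abs_le (abs_waveCov_le hH m d))
    _ ≤ _ := summable_one_div_one_add_abs_sq.sum_le_tsum _ fun _ _ => by positivity

end wavelet

section moments
variable {Ω : Type*} [MeasurableSpace Ω] {P : Measure Ω} {H : ℝ} {W : ℝ → Ω → ℝ}

lemma lintegral_abs_sum_le [IsProbabilityMeasure P] {X : ℕ → Ω → ℝ} {I : Finset ℕ} {C : ℝ}
    (hC : 0 ≤ C) (hi : ∀ k ∈ I, ∀ l ∈ I, Integrable (fun ω => X k ω * X l ω) P)
    (h : ∀ k ∈ I, ∑ l ∈ I, ∫ ω, X k ω * X l ω ∂P ≤ C) :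
    ∫⁻ ω, ENNReal.ofReal |∑ k ∈ I, X k ω| ∂P ≤ ENNReal.ofReal ((C + 1) * Real.sqrt I.card) := by
  rcases I.eq_empty_or_nonempty with rfl | hI
  · simp
  have hcard : (0 : ℝ) < I.card := by exact_mod_cast hI.card_pos
  set s := Real.sqrt I.card with hs
  have hs0 : 0 < s := Real.sqrt_pos.2 hcard
  have hss : s * s = I.card := Real.mul_self_sqrt hcard.le
  have e (ω : Ω) : (∑ k ∈ I, X k ω) ^ 2 = ∑ k ∈ I, ∑ l ∈ I, X k ω * X l ω := by
    rw [sq, Finset.sum_mul_sum]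
  have hint : Integrable (fun ω => (∑ k ∈ I, X k ω) ^ 2) P := by
    simp only [e]
    exact integrable_finsetSum _ fun k hk => integrable_finsetSum _ fun l hl => hi k hk l hl
  have hval : ∫ ω, (∑ k ∈ I, X k ω) ^ 2 ∂P ≤ I.card * C := by
    simp only [e]
    rw [integral_finsetSum _ fun k hk => integrable_finsetSum _ fun l hl => hi k hk l hl]
    calc _ ≤ ∑ k ∈ I, C := Finset.sum_le_sum fun k hk => by
          rw [integral_finsetSum _ fun l hl => hi k hk l hl]
          exact h k hk
      _ = I.card * C := by simp
  have hint2 : Integrable (fun ω => (∑ k ∈ I, X k ω) ^ 2 / s + s) P :=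
    (hint.div_const s).add (integrable_const s)
  calc ∫⁻ ω, ENNReal.ofReal |∑ k ∈ I, X k ω| ∂P
      ≤ ∫⁻ ω, ENNReal.ofReal ((∑ k ∈ I, X k ω) ^ 2 / s + s) ∂P := by
        refine lintegral_mono fun ω => ENNReal.ofReal_le_ofReal ?_
        have : |∑ k ∈ I, X k ω| * s ≤ (∑ k ∈ I, X k ω) ^ 2 + s * s := by
          rw [← sq_abs (∑ k ∈ I, X k ω)]
          nlinarith [sq_nonneg (|∑ k ∈ I, X k ω| - s), abs_nonneg (∑ k ∈ I, X k ω)]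
        calc |∑ k ∈ I, X k ω| = |∑ k ∈ I, X k ω| * s / s := by field_simp
          _ ≤ ((∑ k ∈ I, X k ω) ^ 2 + s * s) / s := by gcongr
          _ = _ := by field_simp
    _ = ENNReal.ofReal (∫ ω, ((∑ k ∈ I, X k ω) ^ 2 / s + s) ∂P) :=
        (ofReal_integral_eq_lintegral_ofReal hint2 (Eventually.of_forall fun ω => by positivity)).symm
    _ ≤ _ := by
        refine ENNReal.ofReal_le_ofReal ?_
        rw [integral_add (hint.div_const s) (integrable_const s), integral_div]
        simp only [integral_const, probReal_univ, one_smul]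
        calc (∫ ω, (∑ k ∈ I, X k ω) ^ 2 ∂P) / s + s ≤ (I.card * C) / s + s := by gcongr
          _ = (C + 1) * s := by rw [← hss]; field_simp

lemma IsFBM.measurable_waveCoefApprox (hW : IsFBM P H W) (m n k : ℕ) :
    Measurable fun ω => waveCoefApprox H (fun t => W t ω) m n k :=
  Finset.measurable_fun_sum _ fun _ _ => (hW.1 _).const_mul _

lemma IsFBM.aemeasurable_waveCoef (hW : IsFBM P H W) {n k : ℕ} (hk : k < 2 ^ n) :
    AEMeasurable (fun ω => waveCoef H (fun t => W t ω) n k) P := by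
  refine aemeasurable_of_tendsto_metrizable_ae atTop
    (fun m => (hW.measurable_waveCoefApprox m n k).aemeasurable) ?_
  filter_upwards [hW.2.1] with ω hω
  exact tendsto_waveCoefApprox H hω hk

lemma IsFBM.isGaussPair_waveCoefApprox (hW : IsFBM P H W) (hH : 0 < H) (m : ℕ) {n k l : ℕ}
    (hk : k < 2 ^ n) (hl : l < 2 ^ n) :
    IsGaussPair P (fun ω => waveCoefApprox H (fun t => W t ω) m n k)
      (fun ω => waveCoefApprox H (fun t => W t ω) m n l)
      (waveCov H m 0) (waveCov H m ((k : ℤ) - l)) (waveCov H m 0) := by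
  have ht (a : ℕ) (ha : a < 2 ^ n) (i : Fin m × Fin 4) :
      (4 * a + ((i.2 : ℕ) : ℝ) + ((i.1 : ℕ) : ℝ) / m) / 2 ^ (n + 2) ∈ Set.Icc (0 : ℝ) 1 := by
    refine (mem_Icc_of_wave ha i.2 ?_).2
    exact (div_mem_Icc_of_lt i.1.2 (u := ((i.1 : ℕ) : ℝ) / m) ⟨le_rfl, by gcongr; linarith⟩).1
  have h := hW.isGaussPair hH
    (fun i : Fin m × Fin 4 => (4 * k + ((i.2 : ℕ) : ℝ) + ((i.1 : ℕ) : ℝ) / m) / 2 ^ (n + 2))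
    (fun i => ((2 : ℝ) ^ (n + 2)) ^ H * (1 / m) * waveSign i.2)
    (fun i : Fin m × Fin 4 => (4 * l + ((i.2 : ℕ) : ℝ) + ((i.1 : ℕ) : ℝ) / m) / 2 ^ (n + 2))
    (fun i => ((2 : ℝ) ^ (n + 2)) ^ H * (1 / m) * waveSign i.2) (ht k hk) (ht l hl)
  rw [sum_waveCoefApprox_cov, sum_waveCoefApprox_cov, sum_waveCoefApprox_cov, sub_self,
    sub_self] at h
  exact h

/-- Sums of centred squared wavelet coefficients satisfy a square root bound in `L¹`. -/
lemma IsFBM.exists_lintegral_abs_sum_le [IsProbabilityMeasure P] (hW : IsFBM P H W)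
    (hH : H ∈ Set.Ioo (0 : ℝ) 1) :
    ∃ C : ℝ, 0 ≤ C ∧ ∀ (n : ℕ) (I : Finset ℕ), (∀ k ∈ I, k < 2 ^ n) →
      ∫⁻ ω, ENNReal.ofReal |∑ k ∈ I, (waveCoef H (fun t => W t ω) n k ^ 2 - waveVar H)| ∂P ≤
        ENNReal.ofReal (C * Real.sqrt I.card) := by
  obtain ⟨C, hC, h⟩ := exists_sum_waveCov_sq_le hH
  refine ⟨C + 1, by linarith, fun n I hI => ?_⟩
  set A : ℕ → ℕ → Ω → ℝ := fun m k ω =>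
    waveCoefApprox H (fun t => W t ω) m n k ^ 2 - waveCov H m 0 with hA
  have hm (m k) : Measurable (A m k) :=
    ((hW.measurable_waveCoefApprox m n k).pow_const 2).sub_const _
  have hb (m : ℕ) : ∫⁻ ω, ENNReal.ofReal |∑ k ∈ I, A m k ω| ∂P ≤
      ENNReal.ofReal ((C + 1) * Real.sqrt I.card) := by
    have key (k) (hk : k ∈ I) (l) (hl : l ∈ I) :=
      (hW.isGaussPair_waveCoefApprox hH.1 m (hI k hk) (hI l hl)).integral_sq_sub_mul
        (hW.measurable_waveCoefApprox m n k) (hW.measurable_waveCoefApprox m n l)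
    refine lintegral_abs_sum_le hC (fun k hk l hl => (key k hk l hl).1) fun k hk => ?_
    calc _ = ∑ l ∈ I, 2 * waveCov H m ((k : ℤ) - l) ^ 2 :=
          Finset.sum_congr rfl fun l hl => (key k hk l hl).2
      _ ≤ C := h m k I
  calc _ ≤ ∫⁻ ω, liminf (fun m => ENNReal.ofReal |∑ k ∈ I, A m k ω|) atTop ∂P := by
        refine lintegral_mono_ae ?_
        filter_upwards [hW.2.1] with ω hω
        have hlim : Tendsto (fun m => ENNReal.ofReal |∑ k ∈ I, A m k ω|) atTop
            (nhds (ENNReal.ofReal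
              |∑ k ∈ I, (waveCoef H (fun t => W t ω) n k ^ 2 - waveVar H)|)) := by
          refine (ENNReal.continuous_ofReal.tendsto _).comp (Tendsto.abs ?_)
          refine tendsto_finsetSum _ fun k hk => ?_
          exact ((tendsto_waveCoefApprox H hω (hI k hk)).pow 2).sub (tendsto_waveCov_zero hH.1)
        exact hlim.liminf_eq.ge
    _ ≤ liminf (fun m => ∫⁻ ω, ENNReal.ofReal |∑ k ∈ I, A m k ω| ∂P) atTop :=
        lintegral_liminf_le' fun m =>
          (Finset.measurable_fun_sum I fun k _ => hm m k).abs.ennreal_ofReal.aemeasurable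
    _ ≤ _ := by
        refine liminf_le_of_frequently_le' (Frequently.of_forall hb)

lemma IsFBM.map_waveCoef [IsProbabilityMeasure P] (hW : IsFBM P H W)
    (hH : H ∈ Set.Ioo (0 : ℝ) 1) {n k : ℕ} (hk : k < 2 ^ n) :
    P.map (fun ω => waveCoef H (fun t => W t ω) n k) = gaussianReal 0 (waveVar H).toNNReal := by
  have hmeas := hW.aemeasurable_waveCoef hk
  have := Measure.isProbabilityMeasure_map hmeas
  refine Measure.ext_of_charFun (funext fun t => ?_)
  rw [charFun_gaussianReal, charFun_apply_real, integral_map hmeas (by fun_prop)]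
  have h1 : Tendsto (fun m : ℕ => ∫ ω, Complex.exp (t * waveCoefApprox H (fun t => W t ω) m n k *
      Complex.I) ∂P) atTop (nhds (∫ ω, Complex.exp (t * waveCoef H (fun t => W t ω) n k *
      Complex.I) ∂P)) := by
    refine tendsto_integral_of_dominated_convergence (fun _ => 1) (fun m => ?_)
      (integrable_const _) (fun m => Eventually.of_forall fun ω => ?_) ?_
    · have hm := hW.measurable_waveCoefApprox m n k
      exact (Complex.measurable_exp.comp
        (((Complex.measurable_ofReal.comp hm).const_mul _).mul_const _)).aestronglyMeasurable
    · rw [← Complex.ofReal_mul, Complex.norm_exp_ofReal_mul_I]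
    · filter_upwards [hW.2.1] with ω hω
      have hc : Continuous fun x : ℝ => Complex.exp (t * x * Complex.I) := by fun_prop
      exact (hc.tendsto _).comp (tendsto_waveCoefApprox H hω hk)
  have h2 (m : ℕ) : ∫ ω, Complex.exp (t * waveCoefApprox H (fun t => W t ω) m n k *
      Complex.I) ∂P = Complex.exp (-((waveCov H m 0 : ℝ) * t ^ 2 / 2)) := by
    obtain ⟨v, hv, hl⟩ := hW.isGaussPair_waveCoefApprox hH.1 m hk hk 1 0
    simp only [one_mul, zero_mul, add_zero, one_pow] at hv hl
    have h3 := charFun_gaussianReal (μ := 0) (v := v) t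
    rw [← hl, charFun_apply_real,
      integral_map (hW.measurable_waveCoefApprox m n k).aemeasurable (by fun_prop)] at h3
    rw [h3]
    congr 1
    have : ((v : ℝ) : ℂ) = ((waveCov H m 0 : ℝ) : ℂ) := by rw [hv]; norm_num
    simp only [Complex.ofReal_zero, mul_zero, zero_mul, zero_sub]
    rw [← this]
  refine tendsto_nhds_unique h1 ?_
  simp only [h2]
  have hc : Continuous fun x : ℝ => Complex.exp (-((x : ℂ) * t ^ 2 / 2)) := by fun_prop
  have h4 := (hc.tendsto _).comp (tendsto_waveCov_zero hH.1)
  have hv : (((waveVar H).toNNReal : ℝ) : ℂ) = (waveVar H : ℝ) := by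
    rw [Real.coe_toNNReal _ (waveVar_pos hH).le]
  rw [hv, Complex.ofReal_zero, mul_zero, zero_mul, zero_sub]
  exact h4

end moments

section dyadic

lemma vartheta_integral (H : ℝ) {f : ℝ → ℝ} (hf : ContinuousOn f (Set.Icc 0 1)) {n k : ℕ}
    (hk : k < 2 ^ n) :
    vartheta (fun t => ∫ s in (0 : ℝ)..t, f s) n k =
      (2 : ℝ) ^ ((3 * (n : ℝ)) / 2 + 3) *
        ((((2 : ℝ) ^ (n + 2)) ^ H)⁻¹ * ((2 : ℝ) ^ (n + 2))⁻¹ * waveCoef H f n k) := by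
  have hN : (0 : ℝ) < 2 ^ (n + 2) := by positivity
  have hN' : ((2 : ℝ) ^ (n + 2)) ^ H ≠ 0 := (Real.rpow_pos_of_pos hN _).ne'
  have hint (p : Fin 4) : IntervalIntegrable
      (fun u : ℝ => f ((4 * k + ((p : ℕ) : ℝ) + u) / 2 ^ (n + 2))) volume 0 1 :=
    ContinuousOn.intervalIntegrable (by
      rw [Set.uIcc_of_le zero_le_one]; exact continuousOn_wave hf hk p)
  have hmem (p : Fin 4) (u : ℝ) (hu : u ∈ Set.Icc (0 : ℝ) 1) := (mem_Icc_of_wave hk p hu).2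
  have hfi {a b : ℝ} (ha : a ∈ Set.Icc (0 : ℝ) 1) (hb : b ∈ Set.Icc (0 : ℝ) 1) :
      IntervalIntegrable f volume a b :=
    (hf.mono ((Set.uIcc_subset_Icc ha hb))).intervalIntegrable
  have h00 : (0 : ℝ) ∈ Set.Icc (0 : ℝ) 1 := ⟨le_rfl, zero_le_one⟩
  have h11 : (1 : ℝ) ∈ Set.Icc (0 : ℝ) 1 := ⟨zero_le_one, le_rfl⟩
  have e (p : Fin 4) : ∫ u in (0 : ℝ)..1, f ((4 * k + ((p : ℕ) : ℝ) + u) / 2 ^ (n + 2)) =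
      2 ^ (n + 2) * ((∫ s in (0 : ℝ)..((4 * k + ((p : ℕ) : ℝ) + 1) / 2 ^ (n + 2)), f s) -
        ∫ s in (0 : ℝ)..((4 * k + ((p : ℕ) : ℝ) + 0) / 2 ^ (n + 2)), f s) := by
    rw [intervalIntegral.integral_interval_sub_left (hfi h00 (hmem p 1 h11))
      (hfi h00 (hmem p 0 h00))]
    simp only [add_div _ _ ((2 : ℝ) ^ (n + 2))]
    simp only [← add_div _ (((p : ℕ) : ℝ)) ((2 : ℝ) ^ (n + 2))]
    rw [intervalIntegral.integral_comp_add_div f hN.ne', smul_eq_mul]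
  have w0 : waveSign 0 = -1 := rfl
  have w1 : waveSign 1 = 1 := rfl
  have w2 : waveSign 2 = 1 := rfl
  have w3 : waveSign 3 = -1 := rfl
  have c0 : ((0 : Fin 4) : ℕ) = 0 := rfl
  have c1 : ((1 : Fin 4) : ℕ) = 1 := rfl
  have c2 : ((2 : Fin 4) : ℕ) = 2 := rfl
  have c3 : ((3 : Fin 4) : ℕ) = 3 := rfl
  rw [waveCoef, intervalIntegral.integral_finsetSum fun p _ => (hint p).const_mul _]
  simp only [intervalIntegral.integral_const_mul, e, Fin.sum_univ_four, w0, w1, w2, w3, c0, c1, c2,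
    c3]
  push_cast
  have d1 : (4 * (k : ℝ) + 1 + 1) = 4 * k + 2 := by ring
  have d2 : (4 * (k : ℝ) + 2 + 1) = 4 * k + 3 := by ring
  have d3 : (4 * (k : ℝ) + 3 + 1) = 4 * k + 4 := by ring
  simp only [add_zero, d1, d2, d3, vartheta]
  congr 1
  field_simp
  ring

lemma vartheta_integral_sq (H : ℝ) {f : ℝ → ℝ} (hf : ContinuousOn f (Set.Icc 0 1)) {n k : ℕ}
    (hk : k < 2 ^ n) :
    vartheta (fun t => ∫ s in (0 : ℝ)..t, f s) n k ^ 2 =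
      (2 : ℝ) ^ (2 - 4 * H) * (2 : ℝ) ^ ((1 - 2 * H) * n) * waveCoef H f n k ^ 2 := by
  have h2 : (0 : ℝ) < 2 := by norm_num
  have e1 : (2 : ℝ) ^ (n + 2) = (2 : ℝ) ^ ((n : ℝ) + 2) := by
    rw [← Real.rpow_natCast]; push_cast; rfl
  rw [vartheta_integral H hf hk, e1, ← Real.rpow_mul h2.le, ← Real.rpow_neg h2.le,
    ← Real.rpow_neg h2.le, ← mul_assoc, ← mul_assoc, mul_pow, ← Real.rpow_add h2,
    ← Real.rpow_add h2, ← Real.rpow_add h2]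
  congr 1
  rw [← Real.rpow_natCast, ← Real.rpow_mul h2.le]
  congr 1
  push_cast
  ring

lemma vartheta_div (f : ℝ → ℝ) (c : ℝ) (n k : ℕ) :
    vartheta (fun t => f t / c) n k = vartheta f n k / c := by
  simp only [vartheta]; ring

lemma abs_waveCoef_sub_mul_le {H : ℝ} {f x : ℝ → ℝ} (hf : ContinuousOn f (Set.Icc 0 1))
    (hx : ContinuousOn x (Set.Icc 0 1)) {n k : ℕ} (hk : k < 2 ^ n) {b e K : ℝ}
    (h : ∀ s ∈ Set.Icc (k / 2 ^ n : ℝ) ((k + 1) / 2 ^ n), |f s - b * x s - e| ≤ K) :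
    |waveCoef H f n k - b * waveCoef H x n k| ≤ ((2 : ℝ) ^ (n + 2)) ^ H * (4 * K) := by
  have hint {y : ℝ → ℝ} (hy : ContinuousOn y (Set.Icc 0 1)) : IntervalIntegrable
      (fun u : ℝ => ∑ p : Fin 4, waveSign p * y ((4 * k + ((p : ℕ) : ℝ) + u) / 2 ^ (n + 2)))
      volume 0 1 :=
    ContinuousOn.intervalIntegrable (by
      rw [Set.uIcc_of_le zero_le_one]
      exact continuousOn_finsetSum _ fun p _ => continuousOn_const.mul (continuousOn_wave hy hk p))
  have hN : (0 : ℝ) < ((2 : ℝ) ^ (n + 2)) ^ H := by positivity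
  have eq : waveCoef H f n k - b * waveCoef H x n k = ((2 : ℝ) ^ (n + 2)) ^ H *
      ∫ u in (0 : ℝ)..1,
        ((∑ p : Fin 4, waveSign p * f ((4 * k + ((p : ℕ) : ℝ) + u) / 2 ^ (n + 2))) -
        b * ∑ p : Fin 4, waveSign p * x ((4 * k + ((p : ℕ) : ℝ) + u) / 2 ^ (n + 2))) := by
    rw [intervalIntegral.integral_sub (hint hf) ((hint hx).const_mul b),
      intervalIntegral.integral_const_mul, waveCoef, waveCoef]
    ring
  rw [eq, abs_mul, abs_of_pos hN]
  refine mul_le_mul_of_nonneg_left ?_ hN.le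
  rw [← Real.norm_eq_abs]
  refine (intervalIntegral.norm_integral_le_of_norm_le_const (C := 4 * K) fun u hu => ?_).trans
    (by simp)
  rw [Set.uIoc_of_le zero_le_one] at hu
  have hp (p : Fin 4) := h _ (mem_Icc_of_wave hk p (Set.Ioc_subset_Icc_self hu)).1
  have h0 := abs_le.1 (hp 0)
  have h1 := abs_le.1 (hp 1)
  have h2 := abs_le.1 (hp 2)
  have h3 := abs_le.1 (hp 3)
  have w0 : waveSign 0 = -1 := rfl
  have w1 : waveSign 1 = 1 := rfl
  have w2 : waveSign 2 = 1 := rfl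
  have w3 : waveSign 3 = -1 := rfl
  rw [Real.norm_eq_abs]
  simp only [Fin.sum_univ_four, w0, w1, w2, w3]
  rw [abs_le]
  constructor <;> linarith [h0.1, h0.2, h1.1, h1.2, h2.1, h2.2, h3.1, h3.2]

/-- The sum of `X` over the `j`-th block of length `2 ^ r`. -/
def blockSum (X : ℕ → ℝ) (r j : ℕ) : ℝ :=
  ∑ k ∈ Finset.Ico (j * 2 ^ r) ((j + 1) * 2 ^ r), X k

lemma blockSum_succ (X : ℕ → ℝ) (r j : ℕ) :
    blockSum X (r + 1) j = blockSum X r (2 * j) + blockSum X r (2 * j + 1) := by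
  unfold blockSum
  rw [Finset.sum_Ico_consecutive _ (by gcongr; omega) (by gcongr; omega)]
  congr 2 <;> ring

lemma sum_range_two_mul_eq (f : ℕ → ℝ) (N : ℕ) :
    ∑ j ∈ Finset.range (2 * N), f j = ∑ j ∈ Finset.range N, (f (2 * j) + f (2 * j + 1)) := by
  induction N with
  | zero => simp
  | succ N ih =>
    rw [Finset.sum_range_succ, ← ih, show 2 * (N + 1) = 2 * N + 1 + 1 by ring,
      Finset.sum_range_succ, Finset.sum_range_succ, add_assoc]

lemma abs_weighted_sum_le {a : ℝ → ℝ} {C α : ℝ} (hC : 0 ≤ C)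
    (ha : ∀ l k : ℕ, k < 2 ^ l →
      |a ((2 * k + 1) / 2 ^ (l + 1)) - a (k / 2 ^ l)| ≤ C * (2 : ℝ) ^ (-α * l))
    (X : ℕ → ℝ) (n : ℕ) :
    |∑ k ∈ Finset.range (2 ^ n), a (k / 2 ^ n) * X k| ≤ (|a 0| + C * 2 ^ α) *
      ∑ l ∈ Finset.range (n + 1), (2 : ℝ) ^ (-α * l) *
        ∑ j ∈ Finset.range (2 ^ l), |blockSum X (n - l) j| := by
  set T : ℕ → ℝ := fun l => ∑ j ∈ Finset.range (2 ^ l), |blockSum X (n - l) j| with hT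
  have hT0 (l) : 0 ≤ T l := Finset.sum_nonneg fun _ _ => abs_nonneg _
  have key : ∀ l ≤ n, |∑ j ∈ Finset.range (2 ^ l), a (j / 2 ^ l) * blockSum X (n - l) j| ≤
      (|a 0| + C * 2 ^ α) * ∑ i ∈ Finset.range (l + 1), (2 : ℝ) ^ (-α * i) * T i := by
    intro l
    induction l with
    | zero =>
      intro _
      have : 0 ≤ C * 2 ^ α * |blockSum X n 0| := by positivity
      simp only [hT, pow_zero, Finset.range_one, Finset.sum_singleton, Nat.cast_zero, zero_div,
        zero_add, mul_zero, Real.rpow_zero, one_mul, Nat.sub_zero, abs_mul]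
      linarith
    | succ l ih =>
      intro hl
      have ih' := ih (by omega)
      have hr : n - l = (n - (l + 1)) + 1 := by omega
      set r := n - (l + 1) with hrd
      have hdiff : ∑ j ∈ Finset.range (2 ^ (l + 1)), a (j / 2 ^ (l + 1)) * blockSum X r j =
          ∑ j ∈ Finset.range (2 ^ l), a (j / 2 ^ l) * blockSum X (n - l) j +
          ∑ j ∈ Finset.range (2 ^ l), (a ((2 * j + 1) / 2 ^ (l + 1)) - a (j / 2 ^ l)) *
            blockSum X r (2 * j + 1) := by
        rw [pow_succ' 2 l, sum_range_two_mul_eq, ← Finset.sum_add_distrib]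
        refine Finset.sum_congr rfl fun j _ => ?_
        rw [hr, blockSum_succ]
        push_cast
        have : (2 * (j : ℝ)) / (2 * 2 ^ l) = j / 2 ^ l := by field_simp
        rw [pow_succ' (2 : ℝ) l, this]
        ring
      have hinc : |∑ j ∈ Finset.range (2 ^ l), (a ((2 * j + 1) / 2 ^ (l + 1)) - a (j / 2 ^ l)) *
            blockSum X r (2 * j + 1)| ≤ C * (2 : ℝ) ^ (-α * l) * T (l + 1) := by
        refine (Finset.abs_sum_le_sum_abs _ _).trans ?_
        have hT1 : T (l + 1) = ∑ j ∈ Finset.range (2 ^ l),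
            (|blockSum X r (2 * j)| + |blockSum X r (2 * j + 1)|) := by
          simp only [hT]
          rw [show 2 ^ (l + 1) = 2 * 2 ^ l from pow_succ' 2 l, sum_range_two_mul_eq]
        rw [hT1, Finset.mul_sum]
        refine Finset.sum_le_sum fun j hj => ?_
        rw [abs_mul]
        exact mul_le_mul (ha l j (Finset.mem_range.1 hj))
          (le_add_of_nonneg_left (abs_nonneg _)) (abs_nonneg _) (by positivity)
      have hpow : C * (2 : ℝ) ^ (-α * l) = C * 2 ^ α * (2 : ℝ) ^ (-α * ((l + 1 : ℕ) : ℝ)) := by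
        rw [mul_assoc, ← Real.rpow_add (by norm_num)]
        congr 2; push_cast; ring
      rw [Finset.sum_range_succ, mul_add, hdiff]
      refine (abs_add_le _ _).trans (add_le_add ih' (hinc.trans ?_))
      rw [hpow, mul_assoc]
      refine mul_le_mul_of_nonneg_right (le_add_of_nonneg_left (abs_nonneg _)) ?_
      exact mul_nonneg (by positivity) (hT0 _)
  have h := key n le_rfl
  have e (j : ℕ) : blockSum X (n - n) j = X j := by simp [blockSum]
  simpa only [e] using h

end dyadic

section estimator
variable {Ω : Type*} [MeasurableSpace Ω] {P : Measure Ω} {H : ℝ} {W : ℝ → Ω → ℝ}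

/-- The centred squared wavelet coefficients. -/
noncomputable def waveSq (H : ℝ) (x : ℝ → ℝ) (n k : ℕ) : ℝ :=
  waveCoef H x n k ^ 2 - waveVar H

lemma IsFBM.ae_blockSum_bdd [IsProbabilityMeasure P] (hW : IsFBM P H W)
    (hH : H ∈ Set.Ioo (0 : ℝ) 1) {α γ : ℝ} (hα : γ < α) (hγ : γ < 1 / 2) :
    ∀ᵐ ω ∂P, ∃ C : ℝ, 0 ≤ C ∧ ∀ n : ℕ, ((2 : ℝ) ^ n)⁻¹ *
      ∑ l ∈ Finset.range (n + 1), (2 : ℝ) ^ (-α * l) * ∑ j ∈ Finset.range (2 ^ l),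
        |blockSum (waveSq H (fun t => W t ω) n) (n - l) j| ≤ C * (2 : ℝ) ^ (-γ * n) := by
  obtain ⟨C, hC, hbound⟩ := hW.exists_lintegral_abs_sum_le hH
  obtain ⟨β, hγβ, hβα, hβ2⟩ : ∃ β, γ < β ∧ β ≤ α ∧ β ≤ 1 / 2 :=
    ⟨min α (1 / 2), lt_min hα hγ, min_le_left _ _, min_le_right _ _⟩
  have h2 : (0 : ℝ) < 2 := by norm_num
  have hlt {n l : ℕ} (hl : l ≤ n) {j : ℕ} (hj : j < 2 ^ l) :
      ∀ k ∈ Finset.Ico (j * 2 ^ (n - l)) ((j + 1) * 2 ^ (n - l)), k < 2 ^ n := by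
    intro k hk
    refine (Finset.mem_Ico.1 hk).2.trans_le ?_
    calc (j + 1) * 2 ^ (n - l) ≤ 2 ^ l * 2 ^ (n - l) := by gcongr; omega
      _ = 2 ^ n := by rw [← pow_add]; congr 1; omega
  have hmeas {n l : ℕ} (hl : l ≤ n) {j : ℕ} (hj : j < 2 ^ l) :
      AEMeasurable (fun ω => |blockSum (waveSq H (fun t => W t ω) n) (n - l) j|) P := by
    unfold blockSum waveSq
    refine AEMeasurable.abs (Finset.aemeasurable_fun_sum _ fun k hk => ?_)
    exact ((hW.aemeasurable_waveCoef (hlt hl hj k hk)).pow_const 2).sub_const _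
  set w : ℕ → ℕ → ℝ := fun n l => (2 : ℝ) ^ (γ * n) * ((2 : ℝ) ^ n)⁻¹ * (2 : ℝ) ^ (-α * l) with hw
  have hw0 (n l) : 0 ≤ w n l := by positivity
  set f : ℕ → Ω → ℝ := fun n ω => ∑ l ∈ Finset.range (n + 1), ∑ j ∈ Finset.range (2 ^ l),
    w n l * |blockSum (waveSq H (fun t => W t ω) n) (n - l) j| with hf
  have hmf (n) : AEMeasurable (f n) P := by
    refine Finset.aemeasurable_fun_sum _ fun l hl => Finset.aemeasurable_fun_sum _ fun j hj => ?_
    exact (hmeas (Nat.lt_succ_iff.1 (Finset.mem_range.1 hl)) (Finset.mem_range.1 hj)).const_mul _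
  have hfb (n : ℕ) : ∫⁻ ω, ENNReal.ofReal (f n ω) ∂P ≤
      ENNReal.ofReal (C * (n + 1) * ((2 : ℝ) ^ (γ - β)) ^ n) := by
    have e (ω : Ω) : ENNReal.ofReal (f n ω) = ∑ l ∈ Finset.range (n + 1),
        ∑ j ∈ Finset.range (2 ^ l), ENNReal.ofReal (w n l) *
          ENNReal.ofReal |blockSum (waveSq H (fun t => W t ω) n) (n - l) j| := by
      rw [hf, ENNReal.ofReal_sum_of_nonneg fun l _ => Finset.sum_nonneg fun j _ =>
        mul_nonneg (hw0 n l) (abs_nonneg _)]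
      refine Finset.sum_congr rfl fun l _ => ?_
      rw [ENNReal.ofReal_sum_of_nonneg fun j _ => mul_nonneg (hw0 n l) (abs_nonneg _)]
      refine Finset.sum_congr rfl fun j _ => ?_
      rw [ENNReal.ofReal_mul (hw0 n l)]
    have hm (l) (hl : l ∈ Finset.range (n + 1)) (j) (hj : j ∈ Finset.range (2 ^ l)) :
        AEMeasurable (fun ω => ENNReal.ofReal (w n l) *
          ENNReal.ofReal |blockSum (waveSq H (fun t => W t ω) n) (n - l) j|) P :=
      (hmeas (Nat.lt_succ_iff.1 (Finset.mem_range.1 hl))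
        (Finset.mem_range.1 hj)).ennreal_ofReal.const_mul _
    simp only [e]
    rw [lintegral_finsetSum' _ fun l hl => Finset.aemeasurable_fun_sum _ (hm l hl)]
    have hl' (l) (hl : l ∈ Finset.range (n + 1)) :
        ∫⁻ ω, ∑ j ∈ Finset.range (2 ^ l), ENNReal.ofReal (w n l) *
          ENNReal.ofReal |blockSum (waveSq H (fun t => W t ω) n) (n - l) j| ∂P ≤
        ENNReal.ofReal (C * ((2 : ℝ) ^ (γ - β)) ^ n) := by
      have hln := Nat.lt_succ_iff.1 (Finset.mem_range.1 hl)
      rw [lintegral_finsetSum' _ (hm l hl)]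
      have hj' (j) (hj : j ∈ Finset.range (2 ^ l)) :
          ∫⁻ ω, ENNReal.ofReal (w n l) *
            ENNReal.ofReal |blockSum (waveSq H (fun t => W t ω) n) (n - l) j| ∂P ≤
          ENNReal.ofReal (w n l * (C * (2 : ℝ) ^ (((n : ℝ) - l) / 2))) := by
        rw [lintegral_const_mul' _ _ ENNReal.ofReal_ne_top, ENNReal.ofReal_mul (hw0 n l)]
        refine mul_le_mul_right ((hbound n _ (hlt hln (Finset.mem_range.1 hj))).trans
          (le_of_eq ?_)) _
        have hcard : (j + 1) * 2 ^ (n - l) - j * 2 ^ (n - l) = 2 ^ (n - l) := by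
          rw [add_mul, one_mul, Nat.add_sub_cancel_left]
        rw [Nat.card_Ico, hcard, Real.sqrt_eq_rpow]
        push_cast
        rw [← Real.rpow_natCast, ← Real.rpow_mul h2.le, Nat.cast_sub hln]
        congr 3
        ring
      refine (Finset.sum_le_sum hj').trans ?_
      rw [Finset.sum_const, Finset.card_range, nsmul_eq_mul,
        ← ENNReal.ofReal_natCast, ← ENNReal.ofReal_mul (by positivity)]
      refine ENNReal.ofReal_le_ofReal ?_
      have hexp : ((2 ^ l : ℕ) : ℝ) * (w n l * (C * (2 : ℝ) ^ (((n : ℝ) - l) / 2))) =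
          C * (2 : ℝ) ^ (l + (γ * n + -n + -α * l + ((n : ℝ) - l) / 2)) := by
        simp only [hw]
        push_cast
        rw [← Real.rpow_natCast, ← Real.rpow_natCast, ← Real.rpow_neg h2.le, Real.rpow_add h2,
          Real.rpow_add h2, Real.rpow_add h2, Real.rpow_add h2]
        ring
      rw [hexp, ← Real.rpow_natCast, ← Real.rpow_mul h2.le]
      refine mul_le_mul_of_nonneg_left (Real.rpow_le_rpow_of_exponent_le (by norm_num) ?_) hC
      have hln' : (l : ℝ) ≤ n := by exact_mod_cast hln
      have hl0 : (0 : ℝ) ≤ l := by positivity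
      nlinarith
    refine (Finset.sum_le_sum hl').trans (le_of_eq ?_)
    rw [Finset.sum_const, Finset.card_range, nsmul_eq_mul, ← ENNReal.ofReal_natCast,
      ← ENNReal.ofReal_mul (by positivity)]
    congr 1
    push_cast
    ring
  have hsum : Summable fun n : ℕ => C * (n + 1) * ((2 : ℝ) ^ (γ - β)) ^ n := by
    have hr : ‖(2 : ℝ) ^ (γ - β)‖ < 1 := by
      rw [Real.norm_of_nonneg (by positivity)]
      exact Real.rpow_lt_one_of_one_lt_of_neg (by norm_num) (by linarith)
    have h1 := (summable_pow_mul_geometric_of_norm_lt_one 1 hr).mul_left C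
    have h0 := (summable_geometric_of_norm_lt_one hr).mul_left C
    refine (h1.add h0).congr fun n => ?_
    ring
  filter_upwards [ae_bdd_of_summable f hmf _ hsum (fun n => by positivity) hfb] with ω ⟨K, hK, h⟩
  refine ⟨K, hK, fun n => ?_⟩
  have h' := h n
  have hp : (0 : ℝ) < (2 : ℝ) ^ (-γ * n) := by positivity
  have hpp : (2 : ℝ) ^ (-γ * n) * (2 : ℝ) ^ (γ * n) = 1 := by
    rw [← Real.rpow_add h2]; simp
  have e : f n ω * (2 : ℝ) ^ (-γ * n) = ((2 : ℝ) ^ n)⁻¹ *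
      ∑ l ∈ Finset.range (n + 1), (2 : ℝ) ^ (-α * l) * ∑ j ∈ Finset.range (2 ^ l),
        |blockSum (waveSq H (fun t => W t ω) n) (n - l) j| := by
    simp only [hf, hw]
    rw [Finset.sum_mul, Finset.mul_sum]
    refine Finset.sum_congr rfl fun l _ => ?_
    rw [Finset.sum_mul, Finset.mul_sum, Finset.mul_sum]
    refine Finset.sum_congr rfl fun j _ => ?_
    linear_combination (((2 : ℝ) ^ n)⁻¹ * (2 : ℝ) ^ (-α * (l : ℝ)) *
      |blockSum (waveSq H (fun t => W t ω) n) (n - l) j|) * hpp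
  rw [← e]
  exact mul_le_mul_of_nonneg_right h' hp.le

lemma abs_taylor_le {g : ℝ → ℝ} (hg : Differentiable ℝ g) {M L : ℝ}
    (hL : ∀ u ∈ Set.Icc (-M) M, ∀ v ∈ Set.Icc (-M) M, |deriv g v - deriv g u| ≤ L * |v - u|)
    (hL0 : 0 ≤ L) {u v : ℝ} (hu : u ∈ Set.Icc (-M) M) (hv : v ∈ Set.Icc (-M) M) :
    |g v - g u - deriv g u * (v - u)| ≤ L * |v - u| ^ 2 := by
  have h := (convex_uIcc u v).norm_image_sub_le_of_norm_hasDerivWithin_le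
    (f := fun y => g y - deriv g u * y) (f' := fun y => deriv g y - deriv g u)
    (C := L * |v - u|)
    (fun z _ => ((hg z).hasDerivAt.sub
      (by simpa using (hasDerivAt_id' z).const_mul (deriv g u))).hasDerivWithinAt)
    (fun z hz => by
      rw [Real.norm_eq_abs]
      refine (hL u hu z (Set.uIcc_subset_Icc hu hv hz)).trans ?_
      exact mul_le_mul_of_nonneg_left (Set.abs_sub_left_of_mem_uIcc hz) hL0)
    Set.left_mem_uIcc Set.right_mem_uIcc
  simp only [Real.norm_eq_abs] at h
  calc _ = |g v - deriv g u * v - (g u - deriv g u * u)| := by congr 1; ring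
    _ ≤ _ := h.trans (by rw [sq, mul_assoc])

/-- Convergence rate of the normalised quadratic sums of wavelet coefficients of `g ∘ x`. -/
lemma exists_abs_quadratic_sum_sub_le {x : ℝ → ℝ} (hx : ContinuousOn x (Set.Icc 0 1))
    (hH : H ∈ Set.Ioo (0 : ℝ) 1) {g : ℝ → ℝ} (hg : ContDiff ℝ 2 g) {α γ : ℝ}
    (hα0 : 0 ≤ α) (hα : γ ≤ α) (hαγ : 2 * H - 3 * α ≤ -γ)
    (hxα : ∃ C : ℝ, 0 ≤ C ∧ ∀ n k : ℕ, k < 2 ^ n →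
      ∀ s ∈ Set.Icc ((k : ℝ) / 2 ^ n) ((k + 1) / 2 ^ n),
        |x s - x (k / 2 ^ n)| ≤ C * (2 : ℝ) ^ (-α * n))
    (hblock : ∃ C : ℝ, 0 ≤ C ∧ ∀ n : ℕ, ((2 : ℝ) ^ n)⁻¹ *
      ∑ l ∈ Finset.range (n + 1), (2 : ℝ) ^ (-α * l) * ∑ j ∈ Finset.range (2 ^ l),
        |blockSum (waveSq H x n) (n - l) j| ≤ C * (2 : ℝ) ^ (-γ * n)) :
    ∃ C : ℝ, 0 ≤ C ∧ ∀ n : ℕ,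
      |((2 : ℝ) ^ n)⁻¹ * ∑ k ∈ Finset.range (2 ^ n), waveCoef H (fun t => g (x t)) n k ^ 2 -
        waveVar H * ∫ s in (0 : ℝ)..1, (deriv g (x s)) ^ 2| ≤ C * (2 : ℝ) ^ (-γ * n) := by
  obtain ⟨C, hC, hxC⟩ := hxα
  obtain ⟨B, hB, hblk⟩ := hblock
  have h2 : (0 : ℝ) < 2 := by norm_num
  have hV := waveVar_pos hH
  have hgd : Differentiable ℝ g := hg.differentiable (by norm_num)
  have hg1 : ContDiff ℝ 1 (deriv g) := ((contDiff_succ_iff_deriv (n := 1)).1 hg).2.2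
  obtain ⟨M, hM⟩ := isCompact_Icc.exists_bound_of_continuousOn hx
  have hxM (s : ℝ) (hs : s ∈ Set.Icc (0 : ℝ) 1) : x s ∈ Set.Icc (-M) M := abs_le.1 (hM s hs)
  obtain ⟨G, hG⟩ := (isCompact_Icc (a := -M) (b := M)).exists_bound_of_continuousOn
    hg1.continuous.continuousOn
  obtain ⟨L, hL⟩ := (isCompact_Icc (a := -M) (b := M)).exists_bound_of_continuousOn
    (hg1.continuous_deriv le_rfl).continuousOn
  have h0mem : (0 : ℝ) ∈ Set.Icc (0 : ℝ) 1 := ⟨le_rfl, zero_le_one⟩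
  have hG0 : 0 ≤ G := (norm_nonneg _).trans (hG _ (hxM 0 h0mem))
  have hL0 : 0 ≤ L := (norm_nonneg _).trans (hL _ (hxM 0 h0mem))
  have hLip : ∀ u ∈ Set.Icc (-M) M, ∀ v ∈ Set.Icc (-M) M,
      |deriv g v - deriv g u| ≤ L * |v - u| := fun u hu v hv =>
    (convex_Icc (-M) M).norm_image_sub_le_of_norm_deriv_le
      (fun z _ => (hg1.differentiable (by norm_num)) z) hL hu hv
  have hdy {n k : ℕ} (hk : k < 2 ^ n) {s : ℝ}
      (hs : s ∈ Set.Icc ((k : ℝ) / 2 ^ n) ((k + 1) / 2 ^ n)) :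
      s ∈ Set.Icc (0 : ℝ) 1 ∧ (k : ℝ) / 2 ^ n ∈ Set.Icc (0 : ℝ) 1 := by
    have := div_mem_Icc_of_lt hk (u := s) (by push_cast; exact hs)
    push_cast at this
    exact ⟨this.2.1, this.1⟩
  set a : ℝ → ℝ := fun t => (deriv g (x t)) ^ 2 with ha
  have hac : ContinuousOn a (Set.Icc 0 1) := (hg1.continuous.comp_continuousOn hx).pow 2
  set D : ℝ := 2 * G * L * C with hD
  have hD0 : 0 ≤ D := by positivity
  have haD {n k : ℕ} (hk : k < 2 ^ n) {s : ℝ}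
      (hs : s ∈ Set.Icc ((k : ℝ) / 2 ^ n) ((k + 1) / 2 ^ n)) :
      |a s - a (k / 2 ^ n)| ≤ D * (2 : ℝ) ^ (-α * n) := by
    obtain ⟨h1, h3⟩ := hdy hk hs
    have g1 := hG _ (hxM _ h1)
    have g2 := hG _ (hxM _ h3)
    rw [Real.norm_eq_abs] at g1 g2
    have e : a s - a (k / 2 ^ n) = (deriv g (x s) + deriv g (x (k / 2 ^ n))) *
        (deriv g (x s) - deriv g (x (k / 2 ^ n))) := by simp only [ha]; ring
    rw [e, abs_mul]
    calc _ ≤ (2 * G) * (L * (C * (2 : ℝ) ^ (-α * n))) := by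
          refine mul_le_mul ((abs_add_le _ _).trans (by linarith)) ?_ (abs_nonneg _) (by positivity)
          exact (hLip _ (hxM _ h3) _ (hxM _ h1)).trans
            (mul_le_mul_of_nonneg_left (hxC n k hk s hs) hL0)
      _ = _ := by rw [hD]; ring
  have hgx : ContinuousOn (fun t => g (x t)) (Set.Icc 0 1) := hg.continuous.comp_continuousOn hx
  have hpow : ∀ n : ℕ, (2 : ℝ) ^ (-α * n) ≤ (2 : ℝ) ^ (-γ * n) := fun n =>
    Real.rpow_le_rpow_of_exponent_le (by norm_num)
      (mul_le_mul_of_nonneg_right (by linarith) (by positivity))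
  set E : ℝ := 16 * (2 : ℝ) ^ (4 * H) * (L * C ^ 2) * (L * C ^ 2 + 2 * G * C) with hE
  have hlin (n k : ℕ) (hk : k < 2 ^ n) :
      |waveCoef H (fun t => g (x t)) n k ^ 2 - a (k / 2 ^ n) * waveCoef H x n k ^ 2| ≤
        E * (2 : ℝ) ^ (-γ * n) := by
    set N : ℝ := ((2 : ℝ) ^ (n + 2)) ^ H with hN
    have hN0 : 0 < N := by positivity
    set q : ℝ := (2 : ℝ) ^ (-α * n) with hq
    have hq0 : 0 < q := by positivity
    have hq1 : q ≤ 1 := Real.rpow_le_one_of_one_le_of_nonpos (by norm_num)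
      (mul_nonpos_of_nonpos_of_nonneg (by linarith) (by positivity))
    set y := x (k / 2 ^ n) with hy
    set b := deriv g y with hb
    have hself : (k : ℝ) / 2 ^ n ∈ Set.Icc ((k : ℝ) / 2 ^ n) ((k + 1) / 2 ^ n) :=
      ⟨le_rfl, by gcongr; linarith⟩
    have hyM := hxM _ (hdy hk hself).2
    have hR : |waveCoef H (fun t => g (x t)) n k - b * waveCoef H x n k| ≤
        N * (4 * (L * (C * q) ^ 2)) := by
      refine abs_waveCoef_sub_mul_le hgx hx hk (e := g y - b * y) fun s hs => ?_
      have h1 := abs_taylor_le hgd hLip hL0 hyM (hxM s (hdy hk hs).1)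
      calc _ = |g (x s) - g y - b * (x s - y)| := by congr 1; ring
        _ ≤ L * |x s - y| ^ 2 := h1
        _ ≤ L * (C * q) ^ 2 := by
          refine mul_le_mul_of_nonneg_left (pow_le_pow_left₀ (abs_nonneg _) ?_ 2) hL0
          exact hxC n k hk s hs
    have hξ : |waveCoef H x n k| ≤ N * (4 * (C * q)) := by
      have := abs_waveCoef_sub_mul_le (H := H) hx hx hk (b := 0) (e := y) (K := C * q)
        fun s hs => by rw [zero_mul, sub_zero]; exact hxC n k hk s hs
      simpa using this
    have hbG : |b| ≤ G := hG _ hyM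
    have hsum : |waveCoef H (fun t => g (x t)) n k + b * waveCoef H x n k| ≤
        N * (4 * (L * (C * q) ^ 2)) + 2 * (G * (N * (4 * (C * q)))) := by
      have e : waveCoef H (fun t => g (x t)) n k + b * waveCoef H x n k =
        (waveCoef H (fun t => g (x t)) n k - b * waveCoef H x n k) +
          2 * (b * waveCoef H x n k) := by ring
      rw [e]
      refine (abs_add_le _ _).trans (add_le_add hR ?_)
      rw [abs_mul, abs_mul, abs_of_pos h2]
      exact mul_le_mul_of_nonneg_left (mul_le_mul hbG hξ (abs_nonneg _) hG0) h2.le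
    have hNq : N ^ 2 * q ^ 3 ≤ (2 : ℝ) ^ (4 * H) * (2 : ℝ) ^ (-γ * n) := by
      have e1 : (2 : ℝ) ^ (n + 2) = (2 : ℝ) ^ ((n : ℝ) + 2) := by
        rw [← Real.rpow_natCast]; push_cast; rfl
      rw [hN, hq, e1, ← Real.rpow_mul h2.le, ← Real.rpow_natCast, ← Real.rpow_natCast,
        ← Real.rpow_mul h2.le, ← Real.rpow_mul h2.le, ← Real.rpow_add h2, ← Real.rpow_add h2]
      refine Real.rpow_le_rpow_of_exponent_le (by norm_num) ?_
      push_cast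
      nlinarith [(Nat.cast_nonneg n : (0 : ℝ) ≤ n)]
    have e : waveCoef H (fun t => g (x t)) n k ^ 2 - a (k / 2 ^ n) * waveCoef H x n k ^ 2 =
        (waveCoef H (fun t => g (x t)) n k - b * waveCoef H x n k) *
        (waveCoef H (fun t => g (x t)) n k + b * waveCoef H x n k) := by
      simp only [ha, hb, hy]; ring
    rw [e, abs_mul]
    calc _ ≤ (N * (4 * (L * (C * q) ^ 2))) *
          (N * (4 * (L * (C * q) ^ 2)) + 2 * (G * (N * (4 * (C * q))))) :=
          mul_le_mul hR hsum (abs_nonneg _) (by positivity)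
      _ = 16 * (L * C ^ 2) * (L * C ^ 2 * q + 2 * G * C) * (N ^ 2 * q ^ 3) := by ring
      _ ≤ 16 * (L * C ^ 2) * (L * C ^ 2 * 1 + 2 * G * C) *
          ((2 : ℝ) ^ (4 * H) * (2 : ℝ) ^ (-γ * n)) := by gcongr
      _ = _ := by rw [hE]; ring
  set K : ℝ := |a 0| + D * 2 ^ α with hK
  have hK0 : 0 ≤ K := by positivity
  have hE0 : 0 ≤ E := by positivity
  refine ⟨E + K * B + waveVar H * D, by positivity, fun n => ?_⟩
  have hn : (0 : ℝ) < 2 ^ n := by positivity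
  set δ : ℝ := (2 : ℝ) ^ (-γ * n) with hδ
  have b1 : |((2 : ℝ) ^ n)⁻¹ * ∑ k ∈ Finset.range (2 ^ n),
      (waveCoef H (fun t => g (x t)) n k ^ 2 - a (k / 2 ^ n) * waveCoef H x n k ^ 2)| ≤ E * δ := by
    rw [abs_mul, abs_of_pos (by positivity), inv_mul_le_iff₀ hn]
    refine (Finset.abs_sum_le_sum_abs _ _).trans
      ((Finset.sum_le_sum fun k hk => hlin n k (Finset.mem_range.1 hk)).trans ?_)
    rw [Finset.sum_const, Finset.card_range, nsmul_eq_mul]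
    push_cast
    exact le_rfl
  have b2 : |((2 : ℝ) ^ n)⁻¹ * ∑ k ∈ Finset.range (2 ^ n), a (k / 2 ^ n) * waveSq H x n k| ≤
      K * (B * δ) := by
    rw [abs_mul, abs_of_pos (by positivity)]
    have h1 := abs_weighted_sum_le hD0 (a := a) (α := α) (fun l k hk => haD hk (by
      have hl : (0 : ℝ) < 2 ^ l := by positivity
      constructor
      · rw [pow_succ, div_le_div_iff₀ hl (by positivity)]; nlinarith
      · rw [pow_succ, div_le_div_iff₀ (by positivity) hl]; nlinarith)) (waveSq H x n) n
    calc _ ≤ ((2 : ℝ) ^ n)⁻¹ * (K * ∑ l ∈ Finset.range (n + 1), (2 : ℝ) ^ (-α * l) *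
          ∑ j ∈ Finset.range (2 ^ l), |blockSum (waveSq H x n) (n - l) j|) := by gcongr
      _ = K * (((2 : ℝ) ^ n)⁻¹ * ∑ l ∈ Finset.range (n + 1), (2 : ℝ) ^ (-α * l) *
          ∑ j ∈ Finset.range (2 ^ l), |blockSum (waveSq H x n) (n - l) j|) := by ring
      _ ≤ K * (B * δ) := mul_le_mul_of_nonneg_left (hblk n) hK0
  have b3 : |((2 : ℝ) ^ n)⁻¹ * ∑ k ∈ Finset.range (2 ^ n), a (k / 2 ^ n) -
      ∫ s in (0 : ℝ)..1, a s| ≤ D * δ := by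
    have h1 := abs_riemann_sum_sub_integral_le (f := a) (m := 2 ^ n) (ε := D * δ)
      (ContinuousOn.intervalIntegrable (by rwa [Set.uIcc_of_le zero_le_one])) (by positivity)
      (fun i hi u hu => by
        push_cast at hu ⊢
        exact (haD hi hu).trans (mul_le_mul_of_nonneg_left (hpow n) hD0))
    push_cast at h1
    rwa [one_div] at h1
  have e : ((2 : ℝ) ^ n)⁻¹ * ∑ k ∈ Finset.range (2 ^ n), waveCoef H (fun t => g (x t)) n k ^ 2 -
        waveVar H * ∫ s in (0 : ℝ)..1, a s =
      ((2 : ℝ) ^ n)⁻¹ * ∑ k ∈ Finset.range (2 ^ n),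
        (waveCoef H (fun t => g (x t)) n k ^ 2 - a (k / 2 ^ n) * waveCoef H x n k ^ 2) +
      ((2 : ℝ) ^ n)⁻¹ * ∑ k ∈ Finset.range (2 ^ n), a (k / 2 ^ n) * waveSq H x n k +
      waveVar H * (((2 : ℝ) ^ n)⁻¹ * ∑ k ∈ Finset.range (2 ^ n), a (k / 2 ^ n) -
        ∫ s in (0 : ℝ)..1, a s) := by
    simp only [waveSq, mul_sub, Finset.sum_sub_distrib, ← Finset.sum_mul]
    ring
  rw [e]
  refine (abs_add_three _ _ _).trans ?_
  rw [abs_mul (waveVar H), abs_of_pos hV]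
  have b4 := mul_le_mul_of_nonneg_left b3 hV.le
  linarith

lemma IsFBM.integral_vartheta_sq [IsProbabilityMeasure P] (hW : IsFBM P H W)
    (hH : H ∈ Set.Ioo (0 : ℝ) 1) :
    ∫ ω, (vartheta (fun t => ∫ s in (0 : ℝ)..t, W s ω) 0 0) ^ 2 ∂P =
      (2 : ℝ) ^ (2 - 4 * H) * waveVar H := by
  have h0 : 0 < 2 ^ 0 := by norm_num
  have h1 : ∫ ω, (vartheta (fun t => ∫ s in (0 : ℝ)..t, W s ω) 0 0) ^ 2 ∂P =
      ∫ ω, (2 : ℝ) ^ (2 - 4 * H) * waveCoef H (fun t => W t ω) 0 0 ^ 2 ∂P := by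
    refine integral_congr_ae ?_
    filter_upwards [hW.2.1] with ω hω
    rw [vartheta_integral_sq H hω h0]
    simp
  rw [h1, integral_const_mul, integral_sq_of_map_eq_gaussianReal (hW.aemeasurable_waveCoef h0)
    (hW.map_waveCoef hH h0), Real.coe_toNNReal _ (waveVar_pos hH).le]

lemma abs_log_le_two_mul {q : ℝ} (hq : |q - 1| ≤ 1 / 2) : |Real.log q| ≤ 2 * |q - 1| := by
  have h := abs_le.1 hq
  have hq0 : 0 < q := by linarith
  have h1 := Real.log_le_sub_one_of_pos hq0
  have h2 := Real.one_sub_inv_le_log_of_pos hq0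
  have h3 : |q - 1| * q⁻¹ ≤ |q - 1| * 2 := by
    refine mul_le_mul_of_nonneg_left ?_ (abs_nonneg _)
    rw [inv_le_comm₀ hq0 (by norm_num)]; linarith
  have h4 : 1 - q⁻¹ = (q - 1) * q⁻¹ := by field_simp
  have h5 : |1 - q⁻¹| = |q - 1| * q⁻¹ := by rw [h4, abs_mul, abs_of_pos (inv_pos.2 hq0)]
  rw [abs_le]
  constructor
  · linarith [neg_abs_le (1 - q⁻¹)]
  · linarith [le_abs_self (q - 1), abs_nonneg (q - 1)]

lemma exists_eventually_abs_Rhat_sub_le (hH : H ∈ Set.Ioo (0 : ℝ) 1) {f : ℝ → ℝ}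
    (hf : ContinuousOn f (Set.Icc 0 1)) {J τ γ C : ℝ} (hJ : 0 < J) (hγ : 0 < γ)
    (hτ : τ = (2 : ℝ) ^ (2 - 4 * H) * waveVar H)
    (h : ∀ n : ℕ, |((2 : ℝ) ^ n)⁻¹ * ∑ k ∈ Finset.range (2 ^ n), waveCoef H f n k ^ 2 -
        waveVar H * J| ≤ C * (2 : ℝ) ^ (-γ * n)) :
    ∃ C' : ℝ, ∀ᶠ n : ℕ in atTop,
      |Rhat n (fun t => (∫ s in (0 : ℝ)..t, f s) / Real.sqrt (τ * J)) - H| ≤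
        C' * ((n : ℝ) ^ (-(1 : ℝ) / 2) * (2 : ℝ) ^ (-γ * n)) := by
  have h2 : (0 : ℝ) < 2 := by norm_num
  have hV := waveVar_pos hH
  have hVJ : 0 < waveVar H * J := by positivity
  have hc : (0 : ℝ) < (2 : ℝ) ^ (2 - 4 * H) := by positivity
  have hτJ : 0 < τ * J := by rw [hτ]; positivity
  set q : ℕ → ℝ := fun n =>
    (((2 : ℝ) ^ n)⁻¹ * ∑ k ∈ Finset.range (2 ^ n), waveCoef H f n k ^ 2) / (waveVar H * J) with hq
  have hq1 (n) : |q n - 1| ≤ C / (waveVar H * J) * (2 : ℝ) ^ (-γ * n) := by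
    have e : q n - 1 = (((2 : ℝ) ^ n)⁻¹ * ∑ k ∈ Finset.range (2 ^ n), waveCoef H f n k ^ 2 -
        waveVar H * J) / (waveVar H * J) := by
      simp only [hq]; field_simp
    rw [e, abs_div, abs_of_pos hVJ, div_mul_eq_mul_div]
    exact div_le_div_of_nonneg_right (h n) hVJ.le
  have hlim : Tendsto (fun n : ℕ => C / (waveVar H * J) * (2 : ℝ) ^ (-γ * n)) atTop (nhds 0) := by
    have h1 : Tendsto (fun n : ℕ => ((2 : ℝ) ^ (-γ)) ^ n) atTop (nhds 0) :=
      tendsto_pow_atTop_nhds_zero_of_lt_one (by positivity)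
        (Real.rpow_lt_one_of_one_lt_of_neg (by norm_num) (by linarith))
    have h3 := h1.const_mul (C / (waveVar H * J))
    rw [mul_zero] at h3
    refine h3.congr fun n => ?_
    rw [← Real.rpow_natCast, ← Real.rpow_mul h2.le]
  have hlog : 0 < Real.log 2 := Real.log_pos (by norm_num)
  refine ⟨C / (waveVar H * J) / Real.log 2, ?_⟩
  filter_upwards [hlim.eventually (ge_mem_nhds (by norm_num : (0 : ℝ) < 1 / 2)),
    eventually_ge_atTop 1] with n hn hn1
  have hnR : (1 : ℝ) ≤ n := by exact_mod_cast hn1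
  have hn0 : (0 : ℝ) < n := by linarith
  have hqn := (hq1 n).trans hn
  have hqpos : 0 < q n := by linarith [(abs_le.1 hqn).1]
  have hsum : ∑ k ∈ Finset.range (2 ^ n),
      vartheta (fun t => (∫ s in (0 : ℝ)..t, f s) / Real.sqrt (τ * J)) n k ^ 2 =
      (2 : ℝ) ^ ((2 - 2 * H) * n) * q n := by
    have e1 (k) (hk : k ∈ Finset.range (2 ^ n)) :
        vartheta (fun t => (∫ s in (0 : ℝ)..t, f s) / Real.sqrt (τ * J)) n k ^ 2 =
        (2 : ℝ) ^ (2 - 4 * H) * (2 : ℝ) ^ ((1 - 2 * H) * n) / (τ * J) * waveCoef H f n k ^ 2 := by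
      rw [vartheta_div, div_pow, Real.sq_sqrt hτJ.le,
        vartheta_integral_sq H hf (Finset.mem_range.1 hk)]
      ring
    rw [Finset.sum_congr rfl e1, ← Finset.mul_sum]
    have e2 : (2 : ℝ) ^ ((2 - 2 * H) * n) = (2 : ℝ) ^ ((1 - 2 * H) * n) * 2 ^ n := by
      rw [← Real.rpow_natCast, ← Real.rpow_add h2]; congr 1; ring
    simp only [hq]
    rw [e2, hτ]
    field_simp
  have hR : Rhat n (fun t => (∫ s in (0 : ℝ)..t, f s) / Real.sqrt (τ * J)) - H =
      -(1 / (2 * n * Real.log 2)) * Real.log (q n) := by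
    rw [Rhat, hsum, Real.logb, Real.log_sqrt (by positivity),
      Real.log_mul (by positivity) hqpos.ne', Real.log_rpow h2]
    field_simp
    ring
  rw [hR, abs_mul, abs_neg, abs_of_pos (by positivity)]
  have hp : (0 : ℝ) < (2 : ℝ) ^ (-γ * n) := by positivity
  have hA : 0 ≤ C / (waveVar H * J) * (2 : ℝ) ^ (-γ * n) := (abs_nonneg _).trans (hq1 n)
  have hninv : (n : ℝ)⁻¹ ≤ (n : ℝ) ^ (-(1 : ℝ) / 2) := by
    rw [← Real.rpow_neg_one]
    exact Real.rpow_le_rpow_of_exponent_le hnR (by norm_num)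
  calc 1 / (2 * n * Real.log 2) * |Real.log (q n)|
      ≤ 1 / (2 * n * Real.log 2) * (2 * (C / (waveVar H * J) * (2 : ℝ) ^ (-γ * n))) := by
        refine mul_le_mul_of_nonneg_left ((abs_log_le_two_mul hqn).trans ?_) (by positivity)
        linarith [hq1 n]
    _ = (C / (waveVar H * J) * (2 : ℝ) ^ (-γ * n)) / Real.log 2 * (n : ℝ)⁻¹ := by field_simp
    _ ≤ (C / (waveVar H * J) * (2 : ℝ) ^ (-γ * n)) / Real.log 2 * (n : ℝ) ^ (-(1 : ℝ) / 2) := by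
        gcongr
    _ = _ := by ring

end estimator

/-- Lemma 2.4: for `V_t = ∫₀ᵗ g(W^H_s) ds`, with probability one,
`|𝓡̂_n(V / √(τ_H ∫₀¹ g'(W^H_s)² ds)) − H| = O(n^{-1/2} 2^{-(H/2 ∧ 1/4)n})`,
where `τ_H = E[(ϑ^Y_{0,0})²]` and `Y_t = ∫₀ᵗ W^H_s ds`. -/
theorem stmt1 {Ω : Type*} [MeasurableSpace Ω] (P : Measure Ω) [IsProbabilityMeasure P]
    (H : ℝ) (hH : H ∈ Set.Ioo (0 : ℝ) 1)
    (W : ℝ → Ω → ℝ) (hW : IsFBM P H W)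
    (g : ℝ → ℝ) (hg : ContDiff ℝ 2 g)
    (hpos : ∀ᵐ ω ∂P, 0 < ∫ s in (0 : ℝ)..1, (deriv g (W s ω)) ^ 2)
    (tauH : ℝ)
    (htau : tauH = ∫ ω, (vartheta (fun t => ∫ s in (0 : ℝ)..t, W s ω) 0 0) ^ 2 ∂P) :
    ∀ᵐ ω ∂P, ∃ C : ℝ, ∀ᶠ n : ℕ in atTop,
      |Rhat n (fun t => (∫ s in (0 : ℝ)..t, g (W s ω)) /
          Real.sqrt (tauH * ∫ s in (0 : ℝ)..1, (deriv g (W s ω)) ^ 2)) - H| ≤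
        C * ((n : ℝ) ^ (-(1 : ℝ) / 2) * (2 : ℝ) ^ (-(min (H / 2) (1 / 4)) * n)) := by
  have hγ : 0 < min (H / 2) (1 / 4) := lt_min (by linarith [hH.1]) (by norm_num)
  have hγ1 : min (H / 2) (1 / 4) ≤ H / 2 := min_le_left _ _
  have hγ2 : min (H / 2) (1 / 4) < 1 / 2 := (min_le_right _ _).trans_lt (by norm_num)
  have hγα : min (H / 2) (1 / 4) < 5 * H / 6 := hγ1.trans_lt (by linarith [hH.1])
  filter_upwards [hW.2.1, hpos,
    hW.ae_holder hH.1 (α := 5 * H / 6) (by linarith [hH.1]) (by linarith [hH.1]),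
    hW.ae_blockSum_bdd hH hγα hγ2] with ω hcont hJ hhol hblock
  obtain ⟨C, -, hC⟩ := exists_abs_quadratic_sum_sub_le hcont hH hg (by linarith [hH.1])
    hγα.le (by linarith) hhol hblock
  exact exists_eventually_abs_Rhat_sub_le hH (hg.continuous.comp_continuousOn hcont) hJ hγ
    (htau.trans (hW.integral_vartheta_sq hH)) hC
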